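/- For the 3-user MISO broadcast channel with any fixed hybrid CSIT configuration (i.e., any partition of {1,2,3} into 𝒫, 𝒟, 𝒩), the linear degrees-of-freedom region is exactly LDoF_region = { (d_1,d_2,d_3) : 0 ≤ d_1,d_2,d_3 ≤ 1; for every i ∈ 𝒟 and every permutation π of 𝒫∪𝒟∖{i}, Σ_{j=1}^{|𝒫|+|𝒟|−1} d_{π(j)}/2^j + d_i + Σ_{j∈𝒩} d_j ≤ 1; for every permutation π of 𝒟, Σ_{j∈𝒫} d_j/3 + Σ_{j=1}^{|𝒟|} d_{π(j)}/j + Σ_{j∈𝒩} d_j ≤ 1; and for every i ∈ 𝒫∪𝒟, d_i + Σ_{j∈𝒩} d_j ≤ 1 }. -/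

import Mathlib

open MeasureTheory Matrix Filter Topology

noncomputable section

/-- CSIT state of a receiver: instantaneous (`P`), delayed (`D`), or none (`N`). -/
inductive CSITState : Type
  | P : CSITState
  | D : CSITState
  | N : CSITState
  deriving DecidableEq

/-- A channel realization: for each receiver `j`, time slot `t` and transmit antenna `a`,
the channel coefficient `g j t a`. -/
abbrev Chan (k m n : ℕ) : Type := Fin k → Fin n → Fin m → ℂ

/-- Joint law of the channel coefficients: all entries i.i.d. with common law `μ`. -/
def chanMeasure (k m n : ℕ) (μ : Measure ℂ) : Measure (Chan k m n) :=
  Measure.pi fun _ : Fin k => Measure.pi fun _ : Fin n => Measure.pi fun _ : Fin m => μ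

/-- The block-diagonal channel matrix `G_j^n ∈ ℂ^{n × nm}` of a receiver with
channel vectors `g (t) ∈ ℂ^{1 × m}`. -/
def blockDiag {m n : ℕ} (g : Fin n → Fin m → ℂ) : Matrix (Fin n) (Fin n × Fin m) ℂ :=
  Matrix.of fun t p => if p.1 = t then g t p.2 else 0

/-- A linear coding strategy of block length `n` for the `k`-user MISO BC with `m`
transmit antennas and hybrid CSIT configuration `I`. -/
structure Strategy (k m n : ℕ) (I : Fin k → CSITState) : Type where
  /-- number of information symbols `m_j(n)` for receiver `j` -/
  dim : Fin k → ℕ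
  /-- precoding matrix `V_j(t) ∈ ℂ^{m × m_j(n)}`, a function of the channel realization -/
  pre : (j : Fin k) → Fin n → Chan k m n → Matrix (Fin m) (Fin (dim j)) ℂ
  /-- each precoder is a measurable function of the channels -/
  meas : ∀ j t a c, Measurable fun g => pre j t g a c
  /-- `V_j(t)` depends only on the CSIT available at time `t`: current and past channels of
  receivers with instantaneous CSIT, and strictly past channels of receivers with delayed
  CSIT (and nothing from receivers with no CSIT). -/
  causal : ∀ (j : Fin k) (t : Fin n) (g g' : Chan k m n),
    (∀ i, I i = CSITState.P → ∀ s : Fin n, (s : ℕ) ≤ (t : ℕ) → g i s = g' i s) →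
    (∀ i, I i = CSITState.D → ∀ s : Fin n, (s : ℕ) < (t : ℕ) → g i s = g' i s) →
    pre j t g = pre j t g'

namespace Strategy

variable {k m n : ℕ} {I : Fin k → CSITState}

/-- The overall precoding matrix `V_j^n ∈ ℂ^{nm × m_j(n)}` (vertical concatenation of the
`V_j(t)`). -/
def Vn (f : Strategy k m n I) (j : Fin k) (g : Chan k m n) :
    Matrix (Fin n × Fin m) (Fin (f.dim j)) ℂ :=
  Matrix.of fun r c => f.pre j r.1 g r.2 c

/-- Horizontal concatenation `[∪_{i ∈ S} V_i^n]` of the precoding matrices of the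
receivers in `S`. -/
def VS (f : Strategy k m n I) (S : Finset (Fin k)) (g : Chan k m n) :
    Matrix (Fin n × Fin m) ((i : {x // x ∈ S}) × Fin (f.dim i.1)) ℂ :=
  Matrix.of fun r c => f.Vn c.1.1 g r c.2

/-- The received-signal matrix `G_j^n [∪_{i ∈ S} V_i^n]` at receiver `j`. -/
def recvS (f : Strategy k m n I) (S : Finset (Fin k)) (j : Fin k) (g : Chan k m n) :
    Matrix (Fin n) ((i : {x // x ∈ S}) × Fin (f.dim i.1)) ℂ :=
  blockDiag (g j) * f.VS S g

/-- The received-signal matrix `G_j^n V_j^n` at receiver `j` from its own precoder. -/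
def recv1 (f : Strategy k m n I) (j : Fin k) (g : Chan k m n) :
    Matrix (Fin n) (Fin (f.dim j)) ℂ :=
  blockDiag (g j) * f.Vn j g

/-- `G_j^t [∪_{i ∈ S} V_i^t]`: the received signal matrix restricted to the first `t`
time slots (rows beyond `t` set to zero, so that its rank is that of the truncated
matrix, with the `t = 0` convention of rank `0`). -/
def recvUpTo (f : Strategy k m n I) (S : Finset (Fin k)) (j : Fin k)
    (g : Chan k m n) (t : ℕ) :
    Matrix (Fin n) ((i : {x // x ∈ S}) × Fin (f.dim i.1)) ℂ :=
  Matrix.of fun s c => if (s : ℕ) < t then f.recvS S j g s c else 0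

/-- Decodability: for every receiver `j`, almost surely
`rank[G_j^n[∪_i V_i^n]] − rank[G_j^n[∪_{i ≠ j} V_i^n]] = rank[G_j^n V_j^n] = m_j(n)`. -/
def Decodable (f : Strategy k m n I) (μ : Measure ℂ) : Prop :=
  ∀ j : Fin k, ∀ᵐ g ∂ chanMeasure k m n μ,
    (f.recvS Finset.univ j g).rank - (f.recvS (Finset.univ.erase j) j g).rank
        = (f.recv1 j g).rank ∧
    (f.recv1 j g).rank = f.dim j

end Strategy

/-- A DoF tuple is linearly achievable if there is a sequence of decodable strategies
achieving it in the limit. -/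
def LinAchievable (k m : ℕ) (I : Fin k → CSITState) (μ : Measure ℂ) (d : Fin k → ℝ) : Prop :=
  (∀ j, 0 ≤ d j ∧ d j ≤ 1) ∧
  ∃ F : (n : ℕ) → Strategy k m n I,
    (∀ n, (F n).Decodable μ) ∧
    ∀ j, Tendsto (fun n : ℕ => ((F n).dim j : ℝ) / n) atTop (nhds (d j))

/-- The linear degrees-of-freedom region: closure of the set of linearly achievable tuples. -/
def LDoFRegion (k m : ℕ) (I : Fin k → CSITState) (μ : Measure ℂ) : Set (Fin k → ℝ) :=
  closure {d | LinAchievable k m I μ d}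

/-- The linear sum degrees of freedom. -/
def LDoFSum (k m : ℕ) (I : Fin k → CSITState) (μ : Measure ℂ) : ℝ :=
  sSup ((fun d => ∑ j, d j) '' LDoFRegion k m I μ)

/-- The set `𝒫` of receivers supplying instantaneous CSIT. -/
def stateP (k : ℕ) (I : Fin k → CSITState) : Finset (Fin k) :=
  Finset.univ.filter fun i => I i = CSITState.P

/-- The set `𝒟` of receivers supplying delayed CSIT. -/
def stateD (k : ℕ) (I : Fin k → CSITState) : Finset (Fin k) :=
  Finset.univ.filter fun i => I i = CSITState.D

/-- The set `𝒩` of receivers supplying no CSIT. -/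
def stateN (k : ℕ) (I : Fin k → CSITState) : Finset (Fin k) :=
  Finset.univ.filter fun i => I i = CSITState.N


/-- Fubini in one coordinate: a measurable property that holds almost surely in the `i`-th
coordinate, whatever the other coordinates, holds almost surely. -/
theorem ae_pi_of_forall_update {ι : Type*} [Fintype ι] [DecidableEq ι] {X : ι → Type*}
    [∀ i, MeasurableSpace (X i)] (μ : ∀ i, Measure (X i)) [∀ i, SigmaFinite (μ i)] (i : ι)
    {s : Set (∀ i, X i)} (hs : MeasurableSet s)
    (h : ∀ x, ∀ᵐ y ∂μ i, Function.update x i y ∈ s) : ∀ᵐ x ∂Measure.pi μ, x ∈ s := by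
  rcases isEmpty_or_nonempty (∀ i, X i) with hX | ⟨⟨x₀⟩⟩
  · exact Eventually.of_forall fun x => hX.elim x
  have hm : Measurable (sᶜ.indicator (fun _ => (1 : ENNReal))) :=
    measurable_const.indicator hs.compl
  have key : ∫⁻ x, sᶜ.indicator (fun _ => (1 : ENNReal)) x ∂Measure.pi μ = 0 := by
    rw [lintegral_eq_lmarginal_univ x₀, lmarginal_erase' _ hm (Finset.mem_univ i)]
    have : (fun x => ∫⁻ y, sᶜ.indicator (fun _ => (1 : ENNReal)) (Function.update x i y) ∂μ i)
        = fun _ => 0 := by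
      funext x
      rw [← lintegral_zero (μ := μ i)]
      apply lintegral_congr_ae
      filter_upwards [h x] with y hy
      simp [hy]
    rw [this]
    simp [lmarginal]
  rw [lintegral_indicator hs.compl] at key
  rw [ae_iff]
  simp only [lintegral_const, one_mul, Measure.restrict_apply MeasurableSet.univ,
    Set.univ_inter] at key
  exact key

section Channel

variable {k m n : ℕ} {μ : Measure ℂ} [IsProbabilityMeasure μ]

instance : IsProbabilityMeasure (chanMeasure k m n μ) := by
  unfold chanMeasure; infer_instance

/-- Replace the channel vector of receiver `i` at time `t`. -/
def updSlot (g : Chan k m n) (i : Fin k) (t : Fin n) (h : Fin m → ℂ) : Chan k m n :=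
  Function.update g i (Function.update (g i) t h)

/-- Replace the channel coefficient of receiver `i` at time `t` and antenna `a`. -/
def updCoord (g : Chan k m n) (i : Fin k) (t : Fin n) (a : Fin m) (z : ℂ) : Chan k m n :=
  updSlot g i t (Function.update (g i t) a z)

theorem updSlot_apply (g : Chan k m n) (i : Fin k) (t : Fin n) (h : Fin m → ℂ) (j : Fin k)
    (s : Fin n) : updSlot g i t h j s = if j = i ∧ s = t then h else g j s := by
  unfold updSlot
  by_cases hj : j = i
  · subst hj
    by_cases hs : s = t
    · subst hs; simp
    · simp [hs]
  · simp [hj]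

theorem updSlot_self (g : Chan k m n) (i : Fin k) (t : Fin n) (h : Fin m → ℂ) :
    updSlot g i t h i t = h := by simp [updSlot_apply]

theorem updCoord_apply (g : Chan k m n) (i : Fin k) (t : Fin n) (a : Fin m) (z : ℂ) (j : Fin k)
    (s : Fin n) (b : Fin m) :
    updCoord g i t a z j s b = if j = i ∧ s = t ∧ b = a then z else g j s b := by
  unfold updCoord
  rw [updSlot_apply]
  by_cases hj : j = i ∧ s = t
  · obtain ⟨rfl, rfl⟩ := hj
    by_cases hb : b = a
    · subst hb; simp
    · simp [hb]
  · rw [if_neg hj, if_neg (by tauto)]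

theorem ae_chan_of_forall_updSlot (i : Fin k) (t : Fin n) {s : Set (Chan k m n)}
    (hs : MeasurableSet s)
    (h : ∀ g, ∀ᵐ v ∂(Measure.pi fun _ : Fin m => μ), updSlot g i t v ∈ s) :
    ∀ᵐ g ∂chanMeasure k m n μ, g ∈ s := by
  refine ae_pi_of_forall_update _ i hs fun g => ?_
  refine ae_pi_of_forall_update (s := {y | Function.update g i y ∈ s}) _ t
    ((measurable_update g) hs) fun y => ?_
  filter_upwards [h (Function.update g i y)] with v hv
  simpa [updSlot] using hv

theorem ae_chan_of_forall_updCoord (i : Fin k) (t : Fin n) (a : Fin m) {s : Set (Chan k m n)}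
    (hs : MeasurableSet s) (h : ∀ g, ∀ᵐ z ∂μ, updCoord g i t a z ∈ s) :
    ∀ᵐ g ∂chanMeasure k m n μ, g ∈ s := by
  refine ae_chan_of_forall_updSlot i t hs fun g => ?_
  have hm : Measurable fun v => updSlot g i t v := by
    unfold updSlot
    exact (measurable_update g).comp (measurable_update (g i))
  refine ae_pi_of_forall_update (s := {v | updSlot g i t v ∈ s}) _ a (hm hs) fun v => ?_
  filter_upwards [h (updSlot g i t v)] with z hz
  convert hz using 1
  simp [updCoord, updSlot]

theorem nullSingletonClass_of_ac {μ : Measure ℂ} (hac : μ ≪ (volume : Measure ℂ)) : NullSingletonClass μ :=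
  ⟨fun z => hac (by simp)⟩

/-- A function of the channel that is polynomial in each coefficient separately. -/
structure SepPoly (φ : Chan k m n → ℂ) : Prop where
  meas : Measurable φ
  poly : ∀ g i t a, ∃ q : Polynomial ℂ, ∀ z, φ (updCoord g i t a z) = q.eval z

namespace SepPoly

variable {φ ψ : Chan k m n → ℂ}

theorem coord (i : Fin k) (t : Fin n) (a : Fin m) : SepPoly fun g : Chan k m n => g i t a := by
  refine ⟨by fun_prop, fun g j s b => ?_⟩
  by_cases h : i = j ∧ t = s ∧ a = b
  · exact ⟨Polynomial.X, fun z => by simp [updCoord_apply, h]⟩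
  · exact ⟨Polynomial.C (g i t a), fun z => by rw [updCoord_apply, if_neg h]; simp⟩

theorem add (hφ : SepPoly φ) (hψ : SepPoly ψ) : SepPoly fun g => φ g + ψ g := by
  refine ⟨hφ.meas.add hψ.meas, fun g i t a => ?_⟩
  obtain ⟨p, hp⟩ := hφ.poly g i t a
  obtain ⟨q, hq⟩ := hψ.poly g i t a
  exact ⟨p + q, fun z => by simp [hp, hq]⟩

theorem mul (hφ : SepPoly φ) (hψ : SepPoly ψ) : SepPoly fun g => φ g * ψ g := by
  refine ⟨hφ.meas.mul hψ.meas, fun g i t a => ?_⟩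
  obtain ⟨p, hp⟩ := hφ.poly g i t a
  obtain ⟨q, hq⟩ := hψ.poly g i t a
  exact ⟨p * q, fun z => by simp [hp, hq]⟩

theorem sub (hφ : SepPoly φ) (hψ : SepPoly ψ) : SepPoly fun g => φ g - ψ g := by
  refine ⟨hφ.meas.sub hψ.meas, fun g i t a => ?_⟩
  obtain ⟨p, hp⟩ := hφ.poly g i t a
  obtain ⟨q, hq⟩ := hψ.poly g i t a
  exact ⟨p - q, fun z => by simp [hp, hq]⟩

/-- A separately polynomial function that is not identically zero is almost surely nonzero. -/
theorem ae_ne_zero [NullSingletonClass μ] (hφ : SepPoly φ) (g₀ : Chan k m n) (h₀ : φ g₀ ≠ 0) :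
    ∀ᵐ g ∂chanMeasure k m n μ, φ g ≠ 0 := by
  classical
  let mix (C : Finset (Fin k × Fin n × Fin m)) (g : Chan k m n) : Chan k m n :=
    fun i t a => if (i, t, a) ∈ C then g i t a else g₀ i t a
  have hmix : ∀ C, Measurable (mix C) := by
    intro C
    refine measurable_pi_lambda _ fun i => measurable_pi_lambda _ fun t =>
      measurable_pi_lambda _ fun a => ?_
    by_cases h : (i, t, a) ∈ C
    · simp only [mix, h, if_true]; fun_prop
    · simp only [mix, h, if_false]; fun_prop
  have key : ∀ C, ∀ᵐ g ∂chanMeasure k m n μ, φ (mix C g) ≠ 0 := by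
    intro C
    induction C using Finset.induction_on with
    | empty => exact Eventually.of_forall fun g => by simpa [mix] using h₀
    | insert c C hc ih =>
      obtain ⟨i, t, a⟩ := c
      have hs : MeasurableSet {g : Chan k m n |
          φ (mix C g) = 0 ∨ φ (mix (insert (i, t, a) C) g) ≠ 0} := by
        apply MeasurableSet.union
        · exact (hφ.meas.comp (hmix _)) (measurableSet_singleton 0)
        · exact ((hφ.meas.comp (hmix _)) (measurableSet_singleton 0)).compl
      have := ae_chan_of_forall_updCoord (μ := μ) i t a hs fun g => by
        have e1 : ∀ z, mix C (updCoord g i t a z) = mix C g := by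
          intro z
          funext j s b
          simp only [mix, updCoord_apply]
          by_cases h : j = i ∧ s = t ∧ b = a
          · obtain ⟨rfl, rfl, rfl⟩ := h
            simp [hc]
          · rw [if_neg h]
        have e2 : ∀ z, mix (insert (i, t, a) C) (updCoord g i t a z)
            = updCoord (mix C g) i t a z := by
          intro z
          funext j s b
          simp only [mix, updCoord_apply]
          by_cases h : j = i ∧ s = t ∧ b = a
          · obtain ⟨rfl, rfl, rfl⟩ := h
            simp
          · simp [h]
        by_cases h : φ (mix C g) = 0
        · exact Eventually.of_forall fun z => Or.inl (by rw [e1, h])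
        · obtain ⟨q, hq⟩ := hφ.poly (mix C g) i t a
          have hq0 : q ≠ 0 := by
            rintro rfl
            apply h
            have := hq (g₀ i t a)
            have e3 : updCoord (mix C g) i t a (g₀ i t a) = mix C g := by
              funext j s b
              simp only [mix, updCoord_apply]
              by_cases h : j = i ∧ s = t ∧ b = a
              · obtain ⟨rfl, rfl, rfl⟩ := h
                simp [hc]
              · simp [h]
            rw [e3] at this
            simpa using this
          have hfin : {z | q.IsRoot z}.Finite := Polynomial.finite_setOfPred_isRoot hq0
          have hnull := hfin.measure_zero μ
          rw [← compl_mem_ae_iff] at hnull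
          filter_upwards [hnull] with z hz
          right
          rw [e2, hq]
          exact hz
      filter_upwards [ih, this] with g h1 h2
      exact h2.resolve_left h1
  filter_upwards [key Finset.univ] with g hg
  simpa [mix] using hg

end SepPoly

/-- A nonzero linear form is almost surely nonzero on an i.i.d. atomless vector. -/
theorem ae_dotProduct_ne_zero [NullSingletonClass μ] {c : Fin m → ℂ} (hc : c ≠ 0) :
    ∀ᵐ v ∂(Measure.pi fun _ : Fin m => μ), v ⬝ᵥ c ≠ 0 := by
  obtain ⟨a, ha⟩ : ∃ a, c a ≠ 0 := by
    by_contra! h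
    exact hc (funext h)
  have hm : Measurable fun v : Fin m → ℂ => v ⬝ᵥ c := by
    unfold dotProduct; fun_prop
  refine ae_pi_of_forall_update (s := {v | v ⬝ᵥ c ≠ 0}) _ a
    (hm (measurableSet_singleton 0)).compl fun v => ?_
  have e : ∀ z, Function.update v a z ⬝ᵥ c = z * c a + ∑ b ∈ Finset.univ.erase a, v b * c b := by
    intro z
    unfold dotProduct
    rw [← Finset.add_sum_erase _ _ (Finset.mem_univ a)]
    simp only [Function.update_self]
    congr 1
    refine Finset.sum_congr rfl fun b hb => ?_
    rw [Function.update_of_ne (Finset.ne_of_mem_erase hb)]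
  have hnull := measure_singleton (μ := μ)
    (-(∑ b ∈ Finset.univ.erase a, v b * c b) / c a)
  rw [← compl_mem_ae_iff] at hnull
  filter_upwards [hnull] with z hz
  intro h0
  rw [e] at h0
  apply hz
  rw [Set.mem_singleton_iff, eq_div_iff ha]
  linear_combination h0

variable {E F G : Type*} [NormedAddCommGroup E] [NormedSpace ℂ E]
  [NormedAddCommGroup F] [NormedSpace ℂ F] [FiniteDimensional ℂ F]
  [NormedAddCommGroup G] [NormedSpace ℂ G]

/-- Inclusion of kernels as a bound of norms. -/
theorem ker_le_ker_iff_exists_norm_le (A : E →ₗ[ℂ] F) (B : E →ₗ[ℂ] G) :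
    (∀ x, A x = 0 → B x = 0) ↔ ∃ C : ℕ, ∀ x, ‖B x‖ ≤ C * ‖A x‖ := by
  constructor
  · intro h
    obtain ⟨M, hM⟩ := LinearMap.exists_extend
      ((LinearMap.ker A).liftQ B (fun x hx => h x hx) ∘ₗ A.quotKerEquivRange.symm.toLinearMap)
    have hMA : ∀ x, M (A x) = B x := by
      intro x
      have h1 := LinearMap.congr_fun hM ⟨A x, LinearMap.mem_range_self A x⟩
      have h2 : A.quotKerEquivRange.symm ⟨A x, LinearMap.mem_range_self A x⟩
          = (LinearMap.ker A).mkQ x := A.quotKerEquivRange_symm_apply_image x _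
      simp only [LinearMap.comp_apply, Submodule.subtype_apply, LinearEquiv.coe_coe] at h1
      rw [h1, h2]
      exact Submodule.liftQ_apply _ _ x
    refine ⟨⌈‖LinearMap.toContinuousLinearMap M‖⌉₊, fun x => ?_⟩
    rw [← hMA x]
    exact ((LinearMap.toContinuousLinearMap M).le_opNorm (A x)).trans
      (mul_le_mul_of_nonneg_right (Nat.le_ceil _) (norm_nonneg _))
  · rintro ⟨C, hC⟩ x hx
    have := hC x
    rw [hx, norm_zero, mul_zero] at this
    exact norm_le_zero_iff.mp this

variable [FiniteDimensional ℂ E]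

theorem measurableSet_ker_le_ker {X : Type*} [MeasurableSpace X] [MeasurableSpace F]
    [BorelSpace F] [MeasurableSpace G] [BorelSpace G] (A : X → E →ₗ[ℂ] F) (B : X → E →ₗ[ℂ] G)
    (hA : ∀ x, Measurable fun g => A g x) (hB : ∀ x, Measurable fun g => B g x) :
    MeasurableSet {g | ∀ x, A g x = 0 → B g x = 0} := by
  have : {g | ∀ x, A g x = 0 → B g x = 0} =
      ⋃ C : ℕ, ⋂ i : ℕ, {g | ‖B g (TopologicalSpace.denseSeq E i)‖
        ≤ C * ‖A g (TopologicalSpace.denseSeq E i)‖} := by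
    ext g
    simp only [Set.mem_ofPred_eq, Set.mem_iUnion, Set.mem_iInter, ker_le_ker_iff_exists_norm_le]
    refine exists_congr fun C => ⟨fun h i => h _, fun h x => ?_⟩
    have hcl : IsClosed {x | ‖B g x‖ ≤ C * ‖A g x‖} :=
      isClosed_le ((B g).continuous_of_finiteDimensional.norm)
        (continuous_const.mul (A g).continuous_of_finiteDimensional.norm)
    have hd := (TopologicalSpace.denseRange_denseSeq E).closure_range
    have : closure (Set.range (TopologicalSpace.denseSeq E)) ⊆ {x | ‖B g x‖ ≤ C * ‖A g x‖} :=
      hcl.closure_subset_iff.mpr (by rintro _ ⟨i, rfl⟩; exact h i)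
    exact this (by rw [hd]; trivial)
  rw [this]
  refine MeasurableSet.iUnion fun C => MeasurableSet.iInter fun i => ?_
  exact measurableSet_le (hB _).norm (measurable_const.mul (hA _).norm)

/-- A fresh generic channel vector sees every signal that the transmitter sends at that time and
that has not been resolved yet. -/
theorem ae_fresh [NullSingletonClass μ] [MeasurableSpace F] [BorelSpace F] (i : Fin k) (t : Fin n)
    (A : Chan k m n → E →ₗ[ℂ] F) (W : Chan k m n → E →ₗ[ℂ] (Fin m → ℂ))
    (hA : ∀ x, Measurable fun g => A g x) (hW : ∀ x, Measurable fun g => W g x)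
    (hA' : ∀ g v, A (updSlot g i t v) = A g) (hW' : ∀ g v, W (updSlot g i t v) = W g) :
    ∀ᵐ g ∂chanMeasure k m n μ,
      (∀ x, A g x = 0 → W g x = 0) ∨ ∃ x, A g x = 0 ∧ g i t ⬝ᵥ W g x ≠ 0 := by
  let B (g : Chan k m n) : E →ₗ[ℂ] ℂ :=
    { toFun := fun x => g i t ⬝ᵥ W g x
      map_add' := fun x y => by simp
      map_smul' := fun c x => by simp }
  have hB : ∀ x, Measurable fun g => B g x := by
    intro x
    have := hW x
    simp only [B, LinearMap.coe_mk, AddHom.coe_mk, dotProduct]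
    fun_prop
  have hs := (measurableSet_ker_le_ker A W hA hW).union
    (measurableSet_ker_le_ker A B hA hB).compl
  have := ae_chan_of_forall_updSlot (μ := μ) i t hs fun g => by
    by_cases h : ∀ x, A g x = 0 → W g x = 0
    · refine Eventually.of_forall fun v => Or.inl ?_
      simpa only [Set.mem_ofPred_eq, hA', hW'] using h
    · push Not at h
      obtain ⟨x, hx, hc⟩ := h
      filter_upwards [ae_dotProduct_ne_zero hc] with v hv
      refine Or.inr fun hall => hv ?_
      have := hall x (by rw [hA', hx])
      simpa [B, hW', updSlot_self] using this
  filter_upwards [this] with g hg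
  refine hg.imp id fun h => ?_
  simpa [B] using h

end Channel

section Rank

variable {E F : Type*} [AddCommGroup E] [Module ℂ E] [FiniteDimensional ℂ E]
  [AddCommGroup F] [Module ℂ F]

theorem finrank_map_add_finrank_inf_ker (p : Submodule ℂ E) (f : E →ₗ[ℂ] F) :
    Module.finrank ℂ (p.map f) + Module.finrank ℂ (p ⊓ LinearMap.ker f : Submodule ℂ E)
      = Module.finrank ℂ p := by
  have h := LinearMap.finrank_range_add_finrank_ker (f.domRestrict p)
  rw [LinearMap.range_domRestrict, LinearMap.ker_domRestrict,
    ← Submodule.finrank_map_subtype_eq p, Submodule.map_comap_subtype] at h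
  exact h

theorem finrank_le_finrank_inf_ker_add_one (p : Submodule ℂ E) (f : E →ₗ[ℂ] ℂ) :
    Module.finrank ℂ p ≤ Module.finrank ℂ (p ⊓ LinearMap.ker f : Submodule ℂ E) + 1 := by
  have h := finrank_map_add_finrank_inf_ker p f
  have h1 : Module.finrank ℂ (p.map f) ≤ 1 := by
    simpa using Submodule.finrank_le (p.map f)
  omega

theorem finrank_inf_ker_add_one (p : Submodule ℂ E) (f : E →ₗ[ℂ] ℂ) (hf : ∃ x ∈ p, f x ≠ 0) :
    Module.finrank ℂ (p ⊓ LinearMap.ker f : Submodule ℂ E) + 1 = Module.finrank ℂ p := by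
  refine le_antisymm ?_ (finrank_le_finrank_inf_ker_add_one p f)
  refine Submodule.finrank_lt_finrank_of_lt (lt_of_le_of_ne inf_le_left fun h => ?_)
  obtain ⟨x, hx, hne⟩ := hf
  rw [← h] at hx
  exact hne hx.2

end Rank

namespace Strategy

variable {k m n : ℕ} {I : Fin k → CSITState} (f : Strategy k m n I)

/-- The space of all symbols of a strategy. -/
abbrev Sym : Type := (i : Fin k) → Fin (f.dim i) → ℂ

/-- The signal transmitted at time `t`. -/
def tx (t : Fin n) (g : Chan k m n) : f.Sym →ₗ[ℂ] (Fin m → ℂ) :=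
  ∑ i, (f.pre i t g).mulVecLin ∘ₗ LinearMap.proj i

theorem tx_apply (t : Fin n) (g : Chan k m n) (x : f.Sym) :
    f.tx t g x = ∑ i, f.pre i t g *ᵥ x i := by simp [tx]

/-- The signal received by `j` at time `t`. -/
def rx (g : Chan k m n) (j : Fin k) (t : Fin n) : f.Sym →ₗ[ℂ] ℂ :=
  dotProductBilin ℂ ℂ (g j t) ∘ₗ f.tx t g

theorem rx_apply (g : Chan k m n) (j : Fin k) (t : Fin n) (x : f.Sym) :
    f.rx g j t x = g j t ⬝ᵥ f.tx t g x := rfl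

/-- The space of symbols of the receivers in `S`. -/
def symS (S : Finset (Fin k)) : Submodule ℂ f.Sym where
  carrier := {x | ∀ i ∉ S, x i = 0}
  add_mem' hx hy i hi := by simp [hx i hi, hy i hi]
  zero_mem' _ _ := rfl
  smul_mem' c x hx i hi := by simp [hx i hi]

theorem mem_symS {S : Finset (Fin k)} {x : f.Sym} : x ∈ f.symS S ↔ ∀ i ∉ S, x i = 0 := Iff.rfl

theorem symS_univ : f.symS Finset.univ = ⊤ := by
  ext x; simp [mem_symS]

theorem symS_empty : f.symS ∅ = ⊥ := by
  ext x; simp [mem_symS, funext_iff]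

theorem finrank_symS {S : Finset (Fin k)} {a : Fin k} (ha : a ∈ S) :
    Module.finrank ℂ (f.symS S) = f.dim a + Module.finrank ℂ (f.symS (S.erase a)) := by
  rw [← finrank_map_add_finrank_inf_ker _ (LinearMap.proj a : f.Sym →ₗ[ℂ] _)]
  congr 1
  · have : (f.symS S).map (LinearMap.proj a : f.Sym →ₗ[ℂ] _) = ⊤ := by
      rw [eq_top_iff]
      rintro y -
      refine ⟨Pi.single a y, fun i hi => ?_, by simp⟩
      exact Pi.single_eq_of_ne (by rintro rfl; exact hi ha) _
    rw [this, finrank_top, Module.finrank_fin_fun]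
  · suffices f.symS S ⊓ LinearMap.ker (LinearMap.proj a : f.Sym →ₗ[ℂ] _)
        = f.symS (S.erase a) by rw [this]
    ext x
    simp only [Submodule.mem_inf, mem_symS, LinearMap.mem_ker, LinearMap.proj_apply,
      Finset.mem_erase]
    constructor
    · rintro ⟨h1, h2⟩ i hi
      by_cases hia : i = a
      · exact hia ▸ h2
      · exact h1 i fun h => hi ⟨hia, h⟩
    · intro h
      exact ⟨fun i hi => h i fun h' => hi h'.2, h a fun h' => h'.1 rfl⟩

/-- All the signals received by `j`. -/
def rxAll (g : Chan k m n) (j : Fin k) : f.Sym →ₗ[ℂ] (Fin n → ℂ) :=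
  LinearMap.pi fun t => f.rx g j t

theorem blockDiag_mul_apply (g : Fin n → Fin m → ℂ) {κ : Type*}
    (M : Matrix (Fin n × Fin m) κ ℂ) (t : Fin n) (c : κ) :
    (_root_.blockDiag g * M) t c = ∑ a, g t a * M (t, a) c := by
  simp only [_root_.blockDiag, Matrix.mul_apply, Matrix.of_apply, Fintype.sum_prod_type, ite_mul, zero_mul]
  rw [Finset.sum_eq_single t]
  · simp
  · intro b _ hb; simp [hb]
  · simp

theorem rx_apply' (g : Chan k m n) (j : Fin k) (t : Fin n) (x : f.Sym) :
    f.rx g j t x = ∑ i, ∑ c, (∑ a, g j t a * f.pre i t g a c) * x i c := by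
  simp only [rx_apply, tx_apply, dotProduct, Finset.sum_apply, mulVec, Finset.mul_sum,
    Finset.sum_mul]
  rw [Finset.sum_comm]
  refine Finset.sum_congr rfl fun i _ => ?_
  rw [Finset.sum_comm]
  refine Finset.sum_congr rfl fun c _ => Finset.sum_congr rfl fun a _ => by ring

theorem rank_recvS (S : Finset (Fin k)) (j : Fin k) (g : Chan k m n) :
    (f.recvS S j g).rank = Module.finrank ℂ ((f.symS S).map (f.rxAll g j)) := by
  have key : ∀ x ∈ f.symS S, f.rxAll g j x = f.recvS S j g *ᵥ fun c => x c.1.1 c.2 := by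
    intro x hx
    funext t
    simp only [rxAll, LinearMap.pi_apply, rx_apply', mulVec, dotProduct, recvS,
      blockDiag_mul_apply, VS, Vn, Matrix.of_apply, Fintype.sum_sigma]
    rw [Finset.sum_coe_sort S
      (fun i => ∑ c, (∑ a, g j t a * f.pre i t g a c) * x i c)]
    symm
    refine Finset.sum_subset (Finset.subset_univ S) fun i _ hi => ?_
    simp [hx i hi]
  unfold Matrix.rank
  suffices (f.recvS S j g).mulVecLin.range = (f.symS S).map (f.rxAll g j) by rw [this]
  ext y
  simp only [LinearMap.mem_range, mulVecLin_apply, Submodule.mem_map]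
  constructor
  · rintro ⟨z, rfl⟩
    have hz : (fun i c => if h : i ∈ S then z ⟨⟨i, h⟩, c⟩ else 0 : f.Sym) ∈ f.symS S := by
      intro i hi; funext c; simp [hi]
    refine ⟨_, hz, ?_⟩
    rw [key _ hz]
    congr 1
    funext c
    simp
  · rintro ⟨x, hx, rfl⟩
    exact ⟨_, (key x hx).symm⟩

theorem rank_recv1 (j : Fin k) (g : Chan k m n) :
    (f.recv1 j g).rank = Module.finrank ℂ ((f.symS {j}).map (f.rxAll g j)) := by
  have key : ∀ x ∈ f.symS {j}, f.rxAll g j x = f.recv1 j g *ᵥ x j := by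
    intro x hx
    funext t
    simp only [rxAll, LinearMap.pi_apply, rx_apply', mulVec, dotProduct, recv1,
      blockDiag_mul_apply, Vn, Matrix.of_apply]
    refine Finset.sum_eq_single j (fun i _ hi => ?_) (by simp)
    simp [hx i (by simpa using hi)]
  unfold Matrix.rank
  suffices (f.recv1 j g).mulVecLin.range = (f.symS {j}).map (f.rxAll g j) by rw [this]
  ext y
  simp only [LinearMap.mem_range, mulVecLin_apply, Submodule.mem_map]
  constructor
  · rintro ⟨z, rfl⟩
    have hz : (Pi.single j z : f.Sym) ∈ f.symS {j} := by
      intro i hi; exact Pi.single_eq_of_ne (by simpa using hi) _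
    refine ⟨_, hz, ?_⟩
    rw [key _ hz, Pi.single_eq_same]
  · rintro ⟨x, hx, rfl⟩
    exact ⟨_, (key x hx).symm⟩

/-- Receiver `j` can recover its symbols from the received signals. -/
def Recovers (g : Chan k m n) (j : Fin k) : Prop :=
  ∀ x : f.Sym, (∀ t, f.rx g j t x = 0) → x j = 0

theorem rank_iff_recovers (j : Fin k) (g : Chan k m n) :
    ((f.recvS Finset.univ j g).rank - (f.recvS (Finset.univ.erase j) j g).rank
        = (f.recv1 j g).rank ∧ (f.recv1 j g).rank = f.dim j) ↔ f.Recovers g j := by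
  rw [rank_recvS, rank_recvS, rank_recv1]
  have h1 := finrank_map_add_finrank_inf_ker (f.symS Finset.univ) (f.rxAll g j)
  have h2 := finrank_map_add_finrank_inf_ker (f.symS (Finset.univ.erase j)) (f.rxAll g j)
  have h3 := finrank_map_add_finrank_inf_ker (f.symS {j}) (f.rxAll g j)
  have h4 := f.finrank_symS (Finset.mem_univ j)
  have h5 := f.finrank_symS (Finset.mem_singleton_self j)
  have hle : f.symS (Finset.univ.erase j) ⊓ LinearMap.ker (f.rxAll g j) ≤
      f.symS Finset.univ ⊓ LinearMap.ker (f.rxAll g j) :=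
    inf_le_inf_right _ (by rw [symS_univ]; exact le_top)
  rw [Finset.erase_singleton, symS_empty, finrank_bot] at h5
  have hker : ∀ x, x ∈ LinearMap.ker (f.rxAll g j) ↔ ∀ t, f.rx g j t x = 0 := by
    intro x; simp [rxAll, funext_iff]
  constructor
  · rintro ⟨h6, h7⟩ x hx
    rcases Nat.eq_zero_or_pos (f.dim j) with h0 | h0
    · funext c
      exact absurd c.2 (by omega)
    · have heq := Submodule.eq_of_le_of_finrank_eq hle (by omega)
      have hx' : x ∈ f.symS Finset.univ ⊓ LinearMap.ker (f.rxAll g j) :=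
        ⟨by rw [symS_univ]; trivial, (hker x).mpr hx⟩
      rw [← heq] at hx'
      exact hx'.1 j (by simp)
  · intro h
    have heq : f.symS (Finset.univ.erase j) ⊓ LinearMap.ker (f.rxAll g j) =
        f.symS Finset.univ ⊓ LinearMap.ker (f.rxAll g j) := by
      refine le_antisymm hle ?_
      rintro x ⟨-, hx⟩
      refine ⟨fun i hi => ?_, hx⟩
      obtain rfl : i = j := by simpa using hi
      exact h x ((hker x).mp hx)
    have hbot : f.symS {j} ⊓ LinearMap.ker (f.rxAll g j) = ⊥ := by
      rw [eq_bot_iff]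
      rintro x ⟨hx1, hx2⟩
      rw [Submodule.mem_bot]
      funext i
      by_cases hi : i = j
      · subst hi; exact h x ((hker x).mp hx2)
      · exact hx1 i (by simpa using hi)
    rw [hbot, finrank_bot] at h3
    rw [heq] at h2
    omega

theorem decodable_iff (μ : Measure ℂ) :
    f.Decodable μ ↔ ∀ j, ∀ᵐ g ∂chanMeasure k m n μ, f.Recovers g j := by
  unfold Decodable
  simp only [rank_iff_recovers]

end Strategy

namespace Strategy

variable {k m n : ℕ} {I : Fin k → CSITState} (f : Strategy k m n I)

/-- The symbols of `S` that are invisible in the observations `C`. -/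
def hidden (g : Chan k m n) (C : Set (Fin k × Fin n)) (S : Finset (Fin k)) :
    Submodule ℂ f.Sym :=
  f.symS S ⊓ ⨅ p ∈ C, LinearMap.ker (f.rx g p.1 p.2)

theorem mem_hidden {g : Chan k m n} {C : Set (Fin k × Fin n)} {S : Finset (Fin k)} {x : f.Sym} :
    x ∈ f.hidden g C S ↔ x ∈ f.symS S ∧ ∀ p ∈ C, f.rx g p.1 p.2 x = 0 := by
  simp [hidden]

theorem hidden_insert (g : Chan k m n) (C : Set (Fin k × Fin n)) (S : Finset (Fin k))
    (j : Fin k) (t : Fin n) :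
    f.hidden g (insert (j, t) C) S = f.hidden g C S ⊓ LinearMap.ker (f.rx g j t) := by
  ext x
  simp only [mem_hidden, Set.forall_mem_insert, Submodule.mem_inf, LinearMap.mem_ker]
  tauto

theorem hidden_anti (g : Chan k m n) {C C' : Set (Fin k × Fin n)} (h : C ⊆ C')
    (S : Finset (Fin k)) : f.hidden g C' S ≤ f.hidden g C S := by
  intro x hx
  rw [mem_hidden] at hx ⊢
  exact ⟨hx.1, fun p hp => hx.2 p (h hp)⟩

/-- The observations `C` do not constrain the channel of receiver `i` at time `t`: it is unknown
to the transmitter when it produced the signals observed in `C` and the signal at time `t`. -/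
def Unseen (I : Fin k → CSITState) (i : Fin k) (t : Fin n) (C : Set (Fin k × Fin n)) : Prop :=
  (i, t) ∉ C ∧ (I i = CSITState.N ∨ I i = CSITState.D ∧ ∀ p ∈ C, p.2 ≤ t)

/-- The channel realization is generic: fresh observations are informative and every receiver
can decode. -/
structure Generic (g : Chan k m n) : Prop where
  fresh : ∀ i t C S, Unseen I i t C → (∀ x ∈ f.hidden g C S, f.tx t g x = 0) ∨
    ∃ x ∈ f.hidden g C S, f.rx g i t x ≠ 0
  recovers : ∀ j, f.Recovers g j

theorem pre_updSlot {i : Fin k} {t s : Fin n}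
    (h : I i = CSITState.N ∨ I i = CSITState.D ∧ s ≤ t) (j : Fin k) (g : Chan k m n)
    (v : Fin m → ℂ) : f.pre j s (updSlot g i t v) = f.pre j s g := by
  refine f.causal j s _ _ (fun i' hi' s' _ => ?_) (fun i' hi' s' hs' => ?_)
  · funext a
    rw [updSlot_apply, if_neg]
    rintro ⟨rfl, rfl⟩
    rcases h with h | h
    · rw [h] at hi'; cases hi'
    · rw [h.1] at hi'; cases hi'
  · rw [updSlot_apply, if_neg]
    rintro ⟨rfl, rfl⟩
    rcases h with h | h
    · rw [h] at hi'; cases hi'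
    · have := Fin.le_def.mp h.2
      omega

theorem tx_updSlot {i : Fin k} {t s : Fin n}
    (h : I i = CSITState.N ∨ I i = CSITState.D ∧ s ≤ t) (g : Chan k m n)
    (v : Fin m → ℂ) : f.tx s (updSlot g i t v) = f.tx s g := by
  simp only [tx, f.pre_updSlot h]

theorem measurable_tx (t : Fin n) (x : f.Sym) : Measurable fun g => f.tx t g x := by
  refine measurable_pi_lambda _ fun a => ?_
  simp only [tx_apply, Finset.sum_apply, mulVec, dotProduct]
  refine Finset.measurable_sum _ fun i _ => Finset.measurable_sum _ fun c _ => ?_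
  exact (f.meas i t a c).mul_const _

theorem measurable_rx (j : Fin k) (t : Fin n) (x : f.Sym) : Measurable fun g => f.rx g j t x := by
  simp only [rx_apply, dotProduct]
  refine Finset.measurable_sum _ fun a _ => ?_
  exact Measurable.mul (by fun_prop) ((measurable_pi_apply a).comp (f.measurable_tx t x))

open scoped Classical in
theorem ae_fresh_hidden {μ : Measure ℂ} [IsProbabilityMeasure μ] [NullSingletonClass μ]
    (i : Fin k) (t : Fin n) (C : Set (Fin k × Fin n)) (S : Finset (Fin k))
    (h : Unseen I i t C) : ∀ᵐ g ∂chanMeasure k m n μ,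
      (∀ x ∈ f.hidden g C S, f.tx t g x = 0) ∨ ∃ x ∈ f.hidden g C S, f.rx g i t x ≠ 0 := by
  let off : f.Sym →ₗ[ℂ] f.Sym :=
    LinearMap.pi fun j => if j ∈ S then 0 else LinearMap.proj j
  let obs (g : Chan k m n) : f.Sym →ₗ[ℂ] (Fin k × Fin n → ℂ) :=
    LinearMap.pi fun p => if p ∈ C then f.rx g p.1 p.2 else 0
  let A (g : Chan k m n) : f.Sym →ₗ[ℂ] f.Sym × (Fin k × Fin n → ℂ) := off.prod (obs g)
  have hA0 : ∀ g x, A g x = 0 ↔ x ∈ f.hidden g C S := by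
    intro g x
    change (off x, obs g x) = 0 ↔ _
    rw [Prod.mk_eq_zero, mem_hidden, funext_iff, funext_iff, mem_symS]
    simp only [off, obs, LinearMap.pi_apply, Pi.zero_apply]
    refine and_congr (forall_congr' fun j => ?_) (forall_congr' fun p => ?_)
    · by_cases hj : j ∈ S <;> simp [hj, funext_iff]
    · by_cases hp : p ∈ C <;> simp [hp]
  have hrx : ∀ g v, ∀ p ∈ C, f.rx (updSlot g i t v) p.1 p.2 = f.rx g p.1 p.2 := by
    intro g v p hp
    have h1 : p ≠ (i, t) := by rintro rfl; exact h.1 hp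
    have h2 : updSlot g i t v p.1 p.2 = g p.1 p.2 := by
      rw [updSlot_apply, if_neg]
      exact fun h' => h1 (Prod.ext h'.1 h'.2)
    rw [rx, rx, h2, f.tx_updSlot (h.2.imp id fun h' => ⟨h'.1, h'.2 p hp⟩)]
  have hmeas : ∀ x, Measurable fun g => A g x := by
    intro x
    refine Measurable.prodMk measurable_const (measurable_pi_lambda _ fun p => ?_)
    by_cases hp : p ∈ C
    · simpa [obs, hp] using f.measurable_rx p.1 p.2 x
    · simp [obs, hp]
  have := ae_fresh (μ := μ) i t A (fun g => f.tx t g) hmeas (f.measurable_tx t)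
    (fun g v => by
      have hobs : obs (updSlot g i t v) = obs g := by
        refine congrArg LinearMap.pi (funext fun p => ?_)
        by_cases hp : p ∈ C
        · simp only [hp, if_true, hrx g v p hp]
        · simp only [hp, if_false]
      simp only [A, hobs])
    (fun g v => f.tx_updSlot (h.2.imp id fun h' => ⟨h'.1, le_rfl⟩) g v)
  filter_upwards [this] with g hg
  simpa only [hA0, rx_apply] using hg

theorem exists_generic {μ : Measure ℂ} [IsProbabilityMeasure μ] [NullSingletonClass μ]
    (hf : f.Decodable μ) : ∃ g, f.Generic g := by
  have h1 : ∀ᵐ g ∂chanMeasure k m n μ, ∀ i t C S, Unseen I i t C →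
      (∀ x ∈ f.hidden g C S, f.tx t g x = 0) ∨ ∃ x ∈ f.hidden g C S, f.rx g i t x ≠ 0 := by
    simp only [ae_all_iff]
    exact fun i t C S h => f.ae_fresh_hidden i t C S h
  have h2 := ae_all_iff.mpr ((f.decodable_iff μ).mp hf)
  obtain ⟨g, hg1, hg2⟩ := (h1.and h2).exists
  exact ⟨g, hg1, hg2⟩

/-- The number of dimensions that the symbols of `S` occupy in the observations `C`. -/
def rk (g : Chan k m n) (C : Set (Fin k × Fin n)) (S : Finset (Fin k)) : ℝ :=
  Module.finrank ℂ (f.symS S) - Module.finrank ℂ (f.hidden g C S)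

theorem rk_mono (g : Chan k m n) {C C' : Set (Fin k × Fin n)} (h : C ⊆ C')
    (S : Finset (Fin k)) : f.rk g C S ≤ f.rk g C' S := by
  unfold rk
  have := Submodule.finrank_mono (f.hidden_anti g h S)
  have : (Module.finrank ℂ (f.hidden g C' S) : ℝ) ≤ Module.finrank ℂ (f.hidden g C S) := by
    exact_mod_cast this
  linarith

theorem rk_empty (g : Chan k m n) (S : Finset (Fin k)) : f.rk g ∅ S = 0 := by
  have : f.hidden g ∅ S = f.symS S := by ext x; simp [mem_hidden]
  rw [rk, this, sub_self]

theorem rk_nonneg (g : Chan k m n) (C : Set (Fin k × Fin n)) (S : Finset (Fin k)) :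
    0 ≤ f.rk g C S := by
  rw [← f.rk_empty g S]
  exact f.rk_mono g (Set.empty_subset _) S

theorem rk_insert_le (g : Chan k m n) (C : Set (Fin k × Fin n)) (S : Finset (Fin k))
    (p : Fin k × Fin n) : f.rk g (insert p C) S ≤ f.rk g C S + 1 := by
  have := finrank_le_finrank_inf_ker_add_one (f.hidden g C S) (f.rx g p.1 p.2)
  rw [← hidden_insert] at this
  have : (Module.finrank ℂ (f.hidden g C S) : ℝ) ≤
    Module.finrank ℂ (f.hidden g (insert p C) S) + 1 := by exact_mod_cast this
  unfold rk
  linarith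

theorem rk_insert_eq_of_tx {g : Chan k m n} {C C' : Set (Fin k × Fin n)} {S : Finset (Fin k)}
    {t : Fin n} (h : ∀ x ∈ f.hidden g C S, f.tx t g x = 0) (hC : C ⊆ C') (j : Fin k) :
    f.rk g (insert (j, t) C') S = f.rk g C' S := by
  have : f.hidden g (insert (j, t) C') S = f.hidden g C' S := by
    rw [hidden_insert]
    refine inf_eq_left.mpr fun x hx => ?_
    rw [LinearMap.mem_ker, rx_apply, h x (f.hidden_anti g hC S hx), dotProduct_zero]
  rw [rk, this, rk]

theorem rk_insert_eq_of_rx {g : Chan k m n} {C : Set (Fin k × Fin n)} {S : Finset (Fin k)}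
    {j : Fin k} {t : Fin n} (h : ∃ x ∈ f.hidden g C S, f.rx g j t x ≠ 0) :
    f.rk g (insert (j, t) C) S = f.rk g C S + 1 := by
  have := finrank_inf_ker_add_one _ _ h
  rw [← hidden_insert] at this
  have : (Module.finrank ℂ (f.hidden g (insert (j, t) C) S) : ℝ) + 1 =
    Module.finrank ℂ (f.hidden g C S) := by exact_mod_cast this
  unfold rk
  linarith

/-- All observations of the receivers in `J` before time `τ`. -/
def obs (n : ℕ) (J : Finset (Fin k)) (τ : ℕ) : Set (Fin k × Fin n) :=
  {p | p.1 ∈ J ∧ (p.2 : ℕ) < τ}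

theorem obs_zero (J : Finset (Fin k)) : obs n J 0 = ∅ := by
  ext p; simp [obs]

theorem obs_mono {J J' : Finset (Fin k)} (h : J ⊆ J') (τ : ℕ) : obs n J τ ⊆ obs n J' τ :=
  fun _ hp => ⟨h hp.1, hp.2⟩

theorem obs_succ_singleton (i : Fin k) (t : Fin n) :
    obs n {i} (t + 1) = insert (i, t) (obs n {i} t) := by
  ext ⟨j, s⟩
  simp only [obs, Set.mem_ofPred_eq, Finset.mem_singleton, Set.mem_insert_iff, Prod.mk.injEq,
    Fin.ext_iff]
  have := s.2
  omega

theorem obs_succ_pair (i j : Fin k) (t : Fin n) :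
    obs n {i, j} (t + 1) = insert (j, t) (insert (i, t) (obs n {i, j} t)) := by
  ext ⟨j, s⟩
  simp only [obs, Set.mem_ofPred_eq, Finset.mem_singleton, Finset.mem_insert, Set.mem_insert_iff,
    Prod.mk.injEq, Fin.ext_iff]
  omega

theorem obs_succ_triple (i j l : Fin k) (t : Fin n) :
    obs n {i, j, l} (t + 1) =
      insert (l, t) (insert (j, t) (insert (i, t) (obs n {i, j, l} t))) := by
  ext ⟨j, s⟩
  simp only [obs, Set.mem_ofPred_eq, Finset.mem_singleton, Finset.mem_insert, Set.mem_insert_iff,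
    Prod.mk.injEq, Fin.ext_iff]
  omega

variable {f}

theorem Generic.rk_pair_le {g : Chan k m n} (hg : f.Generic g) {i : Fin k}
    (hi : I i = CSITState.D) (j : Fin k) (S : Finset (Fin k)) :
    ∀ τ ≤ n, f.rk g (obs n {i, j} τ) S ≤ 2 * f.rk g (obs n {i} τ) S
  | 0, _ => by simp [obs_zero, rk_empty]
  | τ + 1, hτ => by
    have ih := hg.rk_pair_le hi j S τ (by omega)
    let t : Fin n := ⟨τ, hτ⟩
    change f.rk g (obs n {i, j} (t + 1)) S ≤ 2 * f.rk g (obs n {i} (t + 1)) S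
    change f.rk g (obs n {i, j} t) S ≤ 2 * f.rk g (obs n {i} t) S at ih
    rw [obs_succ_pair, obs_succ_singleton]
    have hU : Unseen I i t (obs n {i} t) :=
      ⟨fun h => lt_irrefl _ h.2, Or.inr ⟨hi, fun p hp => Fin.le_def.mpr hp.2.le⟩⟩
    rcases hg.fresh i t _ S hU with h | h
    · have h1 : obs n {i} t ⊆ obs n {i, j} t := obs_mono (by simp) _
      rw [f.rk_insert_eq_of_tx h subset_rfl,
        f.rk_insert_eq_of_tx h (h1.trans (Set.subset_insert _ _)), f.rk_insert_eq_of_tx h h1]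
      exact ih
    · rw [f.rk_insert_eq_of_rx h]
      have h1 := f.rk_insert_le g (obs n {i, j} t) S (i, t)
      have h2 := f.rk_insert_le g (insert (i, t) (obs n {i, j} t)) S (j, t)
      linarith

theorem Generic.rk_triple_le {g : Chan k m n} (hg : f.Generic g) {i j : Fin k} (hij : i ≠ j)
    (hi : I i = CSITState.D) (hj : I j = CSITState.D) (l : Fin k) (S : Finset (Fin k)) :
    ∀ τ ≤ n, 2 * f.rk g (obs n {i, j, l} τ) S ≤ 3 * f.rk g (obs n {i, j} τ) S
  | 0, _ => by simp [obs_zero, rk_empty]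
  | τ + 1, hτ => by
    have ih := hg.rk_triple_le hij hi hj l S τ (by omega)
    let t : Fin n := ⟨τ, hτ⟩
    change 2 * f.rk g (obs n {i, j, l} (t + 1)) S ≤ 3 * f.rk g (obs n {i, j} (t + 1)) S
    change 2 * f.rk g (obs n {i, j, l} t) S ≤ 3 * f.rk g (obs n {i, j} t) S at ih
    rw [obs_succ_pair, obs_succ_triple]
    have hs : obs n {i, j} t ⊆ obs n {i, j, l} t := by
      refine obs_mono ?_ _
      intro a; simp only [Finset.mem_insert, Finset.mem_singleton]; tauto
    have hs' := Set.insert_subset_insert (a := (i, t)) hs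
    have hs'' : insert (i, t) (obs n {i, j} t) ⊆
        insert (j, t) (insert (i, t) (obs n {i, j, l} t)) := hs'.trans (Set.subset_insert _ _)
    have hU : Unseen I i t (obs n {i, j} t) :=
      ⟨fun h => lt_irrefl _ h.2, Or.inr ⟨hi, fun p hp => Fin.le_def.mpr hp.2.le⟩⟩
    have hU' : Unseen I j t (insert (i, t) (obs n {i, j} t)) := by
      refine ⟨?_, Or.inr ⟨hj, ?_⟩⟩
      · rintro (h | h)
        · exact hij (congrArg Prod.fst h).symm
        · exact lt_irrefl _ h.2
      · rintro p (rfl | h)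
        · exact le_rfl
        · exact Fin.le_def.mpr h.2.le
    have a1 := f.rk_insert_le g (obs n {i, j, l} t) S (i, t)
    have a2 := f.rk_insert_le g (insert (i, t) (obs n {i, j, l} t)) S (j, t)
    have a3 := f.rk_insert_le g (insert (j, t) (insert (i, t) (obs n {i, j, l} t))) S (l, t)
    rcases hg.fresh i t _ S hU with h | h
    · rw [f.rk_insert_eq_of_tx h (Set.subset_insert _ _), f.rk_insert_eq_of_tx h subset_rfl,
        f.rk_insert_eq_of_tx h (hs.trans ((Set.subset_insert _ _).trans (Set.subset_insert _ _))),
        f.rk_insert_eq_of_tx h (hs.trans (Set.subset_insert _ _)), f.rk_insert_eq_of_tx h hs]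
      exact ih
    · have b1 := f.rk_insert_eq_of_rx h
      rcases hg.fresh j t _ S hU' with h' | h'
      · rw [f.rk_insert_eq_of_tx h' subset_rfl, f.rk_insert_eq_of_tx h' hs'',
          f.rk_insert_eq_of_tx h' hs']
        linarith
      · rw [f.rk_insert_eq_of_rx h']
        linarith

theorem Generic.rk_le_of_no_csit {g : Chan k m n} (hg : f.Generic g) {i : Fin k}
    (hi : I i = CSITState.N) (j : Fin k) (S : Finset (Fin k)) :
    f.rk g (obs n {j} n) S ≤ f.rk g (obs n {i} n) S := by
  rcases eq_or_ne i j with rfl | hij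
  · exact le_rfl
  let B (τ : ℕ) : Set (Fin k × Fin n) :=
    {p | p.1 = i ∧ (p.2 : ℕ) < τ ∨ p.1 = j ∧ τ ≤ p.2}
  have key : ∀ τ ≤ n, f.rk g (B 0) S ≤ f.rk g (B τ) S := by
    intro τ
    induction τ with
    | zero => exact fun _ => le_rfl
    | succ τ ih =>
      intro hτ
      refine (ih (by omega)).trans ?_
      let t : Fin n := ⟨τ, hτ⟩
      let B' : Set (Fin k × Fin n) := {p | p.1 = i ∧ (p.2 : ℕ) < τ ∨ p.1 = j ∧ τ < p.2}
      have h1 : B τ = insert (j, t) B' := by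
        ext ⟨j', s⟩
        simp only [B, B', t, Set.mem_ofPred_eq, Set.mem_insert_iff, Prod.mk.injEq, Fin.ext_iff]
        omega
      have h2 : B (τ + 1) = insert (i, t) B' := by
        ext ⟨j', s⟩
        simp only [B, B', t, Set.mem_ofPred_eq, Set.mem_insert_iff, Prod.mk.injEq, Fin.ext_iff]
        omega
      rw [h1, h2]
      have hU : Unseen I i t B' := by
        refine ⟨?_, Or.inl hi⟩
        rintro (⟨_, h⟩ | ⟨h, _⟩)
        · exact lt_irrefl _ h
        · exact hij h
      rcases hg.fresh i t _ S hU with h | h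
      · rw [f.rk_insert_eq_of_tx h subset_rfl, f.rk_insert_eq_of_tx h subset_rfl]
      · rw [f.rk_insert_eq_of_rx h]
        exact f.rk_insert_le _ _ _ _
  have e0 : B 0 = obs n {j} n := by
    ext p; simp [B, obs]
  have en : B n = obs n {i} n := by
    ext p
    have := p.2.2
    simp only [B, obs, Set.mem_ofPred_eq, Finset.mem_singleton]
    omega
  rw [← e0, ← en]
  exact key n le_rfl

theorem rk_singleton_le (g : Chan k m n) (i : Fin k) (S : Finset (Fin k)) :
    ∀ τ ≤ n, f.rk g (obs n {i} τ) S ≤ τ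
  | 0, _ => by simp [obs_zero, rk_empty]
  | τ + 1, hτ => by
    have ih := rk_singleton_le g i S τ (by omega)
    let t : Fin n := ⟨τ, hτ⟩
    change f.rk g (obs n {i} (t + 1)) S ≤ _
    change f.rk g (obs n {i} t) S ≤ _ at ih
    rw [obs_succ_singleton]
    have := f.rk_insert_le g (obs n {i} t) S (i, t)
    push_cast
    linarith

theorem Generic.rk_eq_add {g : Chan k m n} (hg : f.Generic g) {J S : Finset (Fin k)} {a : Fin k}
    (haJ : a ∈ J) (haS : a ∈ S) :
    f.rk g (obs n J n) S = f.dim a + f.rk g (obs n J n) (S.erase a) := by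
  have h1 : f.hidden g (obs n J n) S = f.hidden g (obs n J n) (S.erase a) := by
    ext x
    simp only [mem_hidden]
    refine and_congr_left fun h => ?_
    have h0 : x a = 0 := hg.recovers a x fun t => h (a, t) ⟨haJ, t.2⟩
    simp only [mem_symS, Finset.mem_erase, not_and_or, not_not]
    refine forall_congr' fun i => ⟨?_, fun h' hi => h' (Or.inr hi)⟩
    rintro h' (rfl | hi)
    · exact h0
    · exact h' hi
  have h2 : (Module.finrank ℂ (f.symS S) : ℝ) =
      f.dim a + Module.finrank ℂ (f.symS (S.erase a)) := by exact_mod_cast f.finrank_symS haS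
  rw [rk, rk, h1, h2]
  ring

theorem Generic.sum_add_rk_le {g : Chan k m n} (hg : f.Generic g) (T : Finset (Fin k)) :
    ∀ S : Finset (Fin k), Disjoint T S → (∀ i ∈ T, I i = CSITState.N) → ∀ j,
      ∑ i ∈ T, (f.dim i : ℝ) + f.rk g (obs n {j} n) S ≤ n := by
  induction T using Finset.induction_on with
  | empty =>
    intro S _ _ j
    simpa using f.rk_singleton_le g j S n le_rfl
  | insert a T ha ih =>
    intro S hS hN j
    rw [Finset.disjoint_insert_left] at hS
    rw [Finset.forall_mem_insert] at hN
    have h1 := ih (insert a S) (Finset.disjoint_insert_right.mpr ⟨ha, hS.2⟩) hN.2 a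
    rw [hg.rk_eq_add (Finset.mem_singleton_self a) (Finset.mem_insert_self a S),
      Finset.erase_insert hS.1] at h1
    have h2 := hg.rk_le_of_no_csit hN.1 j S
    rw [Finset.sum_insert ha]
    linarith

theorem Generic.sum_div_two_pow_le {g : Chan k m n} (hg : f.Generic g) {i : Fin k}
    (hi : I i = CSITState.D) {c : ℕ} (v : Fin c → Fin k) (hv : Function.Injective v)
    (S : Finset (Fin k)) (hS : ∀ j, v j ∈ S) :
    ∑ j, (f.dim (v j) : ℝ) / 2 ^ ((j : ℕ) + 1) ≤ f.rk g (obs n {i} n) S := by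
  induction c generalizing S with
  | zero => simpa using f.rk_nonneg g _ S
  | succ c ih =>
    have h1 := ih (v ∘ Fin.succ) (hv.comp (Fin.succ_injective c)) (S.erase (v 0))
      fun j => Finset.mem_erase.mpr ⟨fun h => Fin.succ_ne_zero j (hv h), hS _⟩
    have h2 := hg.rk_pair_le hi (v 0) S n le_rfl
    rw [hg.rk_eq_add (by simp) (hS 0)] at h2
    have h3 := f.rk_mono g (obs_mono (n := n) (J := {i}) (J' := {i, v 0}) (by simp) n)
      (S.erase (v 0))
    rw [Fin.sum_univ_succ]
    have h4 : ∑ j : Fin c, (f.dim (v j.succ) : ℝ) / 2 ^ ((j.succ : ℕ) + 1) =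
        (∑ j : Fin c, (f.dim ((v ∘ Fin.succ) j) : ℝ) / 2 ^ ((j : ℕ) + 1)) / 2 := by
      rw [Finset.sum_div]
      refine Finset.sum_congr rfl fun j _ => ?_
      rw [Fin.val_succ, pow_succ _ ((j : ℕ) + 1), Function.comp_apply, div_div]
    rw [h4]
    simp only [Fin.val_zero, zero_add, pow_one]
    linarith

theorem Generic.rk_delayed_pair_ge {g : Chan k m n} (hg : f.Generic g) {a b p : Fin k}
    (ha : I a = CSITState.D) (hb : I b = CSITState.D) (hab : a ≠ b) (hap : a ≠ p) (hbp : b ≠ p) :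
    (f.dim a : ℝ) + f.dim b / 2 + f.dim p / 3 ≤ f.rk g (obs n {a} n) {a, b, p} := by
  have h1 := hg.rk_eq_add (J := {a}) (S := {a, b, p}) (a := a) (by simp) (by simp)
  rw [Finset.erase_insert (by simp [hab, hap])] at h1
  have h2 := hg.rk_pair_le ha b {b, p} n le_rfl
  rw [hg.rk_eq_add (a := b) (by simp) (by simp), Finset.erase_insert (by simp [hbp])] at h2
  have h3 := hg.rk_triple_le hab ha hb p {p} n le_rfl
  rw [hg.rk_eq_add (a := p) (by simp) (by simp)] at h3
  have h4 := f.rk_nonneg g (obs n {a, b, p} n) (({p} : Finset (Fin k)).erase p)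
  linarith

end Strategy

section Region

variable {k m : ℕ} {I : Fin k → CSITState} {μ : Measure ℂ} {d : Fin k → ℝ}

theorem LDoFRegion_bounds (hd : d ∈ LDoFRegion k m I μ) (j : Fin k) : 0 ≤ d j ∧ d j ≤ 1 := by
  have hc : IsClosed {d : Fin k → ℝ | 0 ≤ d j ∧ d j ≤ 1} :=
    (isClosed_le continuous_const (continuous_apply j)).inter
      (isClosed_le (continuous_apply j) continuous_const)
  exact closure_minimal (fun d' hd' => hd'.1 j) hc hd

/-- A homogeneous bound on the dimensions of decodable strategies bounds the region. -/
theorem LDoFRegion_le (L : (Fin k → ℝ) → ℝ) (hL : Continuous L)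
    (hom : ∀ (c : ℝ) (x : Fin k → ℝ), L (fun j => x j * c) = L x * c)
    (h : ∀ n, ∀ f : Strategy k m n I, f.Decodable μ → L (fun j => f.dim j) ≤ n)
    (hd : d ∈ LDoFRegion k m I μ) : L d ≤ 1 := by
  refine closure_minimal (t := {d | L d ≤ 1}) ?_ (isClosed_le hL continuous_const) hd
  rintro d' ⟨-, F, hF, hlim⟩
  have h1 : Tendsto (fun n : ℕ => L fun j => ((F n).dim j : ℝ) / n) atTop (𝓝 (L d')) :=
    (hL.tendsto d').comp (tendsto_pi_nhds.mpr hlim)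
  refine le_of_tendsto h1 (Eventually.of_forall fun n => ?_)
  simp only [div_eq_mul_inv]
  rw [hom]
  rcases Nat.eq_zero_or_pos n with rfl | hn
  · simp
  · rw [← div_eq_mul_inv, div_le_one (by exact_mod_cast hn)]
    exact h n (F n) (hF n)

variable [IsProbabilityMeasure μ] [NullSingletonClass μ]

theorem mem_stateN {i : Fin k} : i ∈ stateN k I ↔ I i = CSITState.N := by simp [stateN]

theorem mem_stateD {i : Fin k} : i ∈ stateD k I ↔ I i = CSITState.D := by simp [stateD]

theorem mem_stateP {i : Fin k} : i ∈ stateP k I ↔ I i = CSITState.P := by simp [stateP]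

theorem disjoint_stateN_of_subset {S : Finset (Fin k)} (hS : S ⊆ stateP k I ∪ stateD k I) :
    Disjoint (stateN k I) S := by
  rw [Finset.disjoint_right]
  intro i hi
  have := hS hi
  rw [Finset.mem_union, mem_stateP, mem_stateD] at this
  rw [mem_stateN]
  rintro h
  rw [h] at this
  rcases this with h | h <;> cases h

theorem LDoFRegion_sum_le [NeZero k] (hd : d ∈ LDoFRegion k m I μ) :
    ∑ j ∈ stateN k I, d j ≤ 1 := by
  refine LDoFRegion_le (fun d => ∑ j ∈ stateN k I, d j) (by fun_prop)
    (fun c x => by rw [Finset.sum_mul]) (fun n f hf => ?_) hd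
  obtain ⟨g, hg⟩ := f.exists_generic hf
  have h1 := hg.sum_add_rk_le (stateN k I) ∅ (by simp) (fun i hi => mem_stateN.mp hi) 0
  have h2 := f.rk_nonneg g (Strategy.obs n {0} n) ∅
  simp only
  linarith

theorem LDoFRegion_single_le (hd : d ∈ LDoFRegion k m I μ) {i : Fin k}
    (hi : i ∈ stateP k I ∪ stateD k I) : d i + ∑ j ∈ stateN k I, d j ≤ 1 := by
  refine LDoFRegion_le (fun d => d i + ∑ j ∈ stateN k I, d j) (by fun_prop)
    (fun c x => by simp only [add_mul, Finset.sum_mul]) (fun n f hf => ?_) hd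
  obtain ⟨g, hg⟩ := f.exists_generic hf
  have h1 := hg.sum_add_rk_le (stateN k I) {i}
    (disjoint_stateN_of_subset (by simpa using hi)) (fun i hi => mem_stateN.mp hi) i
  rw [hg.rk_eq_add (Finset.mem_singleton_self i) (Finset.mem_singleton_self i)] at h1
  have h2 := f.rk_nonneg g (Strategy.obs n {i} n) (({i} : Finset (Fin k)).erase i)
  simp only
  linarith

theorem LDoFRegion_delayed_le (hd : d ∈ LDoFRegion k m I μ) {i : Fin k} (hi : i ∈ stateD k I)
    {c : ℕ} (v : Fin c → Fin k) (hv : Function.Injective v)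
    (hS : ∀ j, v j ∈ (stateP k I ∪ stateD k I).erase i) :
    (∑ j, d (v j) / (2 : ℝ) ^ ((j : ℕ) + 1)) + d i + ∑ j ∈ stateN k I, d j ≤ 1 := by
  refine LDoFRegion_le
    (fun d => (∑ j, d (v j) / (2 : ℝ) ^ ((j : ℕ) + 1)) + d i + ∑ j ∈ stateN k I, d j)
    (by fun_prop) (fun c x => by simp only [add_mul, Finset.sum_mul, div_mul_eq_mul_div])
    (fun n f hf => ?_) hd
  obtain ⟨g, hg⟩ := f.exists_generic hf
  have h1 := hg.sum_add_rk_le (stateN k I) (stateP k I ∪ stateD k I)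
    (disjoint_stateN_of_subset subset_rfl) (fun i hi => mem_stateN.mp hi) i
  rw [hg.rk_eq_add (Finset.mem_singleton_self i) (Finset.mem_union_right _ hi)] at h1
  have h2 := hg.sum_div_two_pow_le (mem_stateD.mp hi) v hv _ hS
  simp only
  linarith

theorem LDoFRegion_delayed_pair_le (hd : d ∈ LDoFRegion k m I μ) {a b p : Fin k}
    (ha : a ∈ stateD k I) (hb : b ∈ stateD k I) (hp : p ∈ stateP k I ∪ stateD k I)
    (hab : a ≠ b) (hap : a ≠ p) (hbp : b ≠ p) :
    d a + d b / 2 + d p / 3 + ∑ j ∈ stateN k I, d j ≤ 1 := by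
  refine LDoFRegion_le (fun d => d a + d b / 2 + d p / 3 + ∑ j ∈ stateN k I, d j)
    (by fun_prop) (fun c x => by simp only [add_mul, Finset.sum_mul, div_mul_eq_mul_div])
    (fun n f hf => ?_) hd
  obtain ⟨g, hg⟩ := f.exists_generic hf
  have h1 := hg.sum_add_rk_le (stateN k I) {a, b, p} (disjoint_stateN_of_subset (by
    rintro x hx
    simp only [Finset.mem_insert, Finset.mem_singleton] at hx
    rcases hx with rfl | rfl | rfl
    · exact Finset.mem_union_right _ ha
    · exact Finset.mem_union_right _ hb
    · exact hp)) (fun i hi => mem_stateN.mp hi) a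
  have h2 := hg.rk_delayed_pair_ge (mem_stateD.mp ha) (mem_stateD.mp hb) hab hap hbp
  simp only
  linarith

end Region

section Achievability

variable {k m : ℕ} {I : Fin k → CSITState} {μ : Measure ℂ}

/-- Information symbols of all receivers. -/
abbrev Symbols (k : ℕ) : Type := Fin k → ℕ → ℂ

/-- The transmitted signals are a function of the CSIT available to the transmitter. -/
def Causal {m n : ℕ} (I : Fin k → CSITState) {β : Type*} (tx : Fin n → Chan k m n → β) : Prop :=
  ∀ (t : Fin n) (g g' : Chan k m n),
    (∀ i, I i = CSITState.P → ∀ s : Fin n, (s : ℕ) ≤ (t : ℕ) → g i s = g' i s) →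
    (∀ i, I i = CSITState.D → ∀ s : Fin n, (s : ℕ) < (t : ℕ) → g i s = g' i s) →
    tx t g = tx t g'

/-- There is a linear scheme of block length `n` delivering `a j` symbols to each receiver `j`. -/
def Delivers (m : ℕ) (I : Fin k → CSITState) (μ : Measure ℂ) (n : ℕ) (a : Fin k → ℕ) : Prop :=
  ∃ tx : Fin n → Chan k m n → Symbols k →ₗ[ℂ] (Fin m → ℂ),
    (∀ t s, Measurable fun g => tx t g s) ∧ Causal I tx ∧
    ∀ᵐ g ∂chanMeasure k m n μ, ∀ s : Symbols k, (∀ j c, a j ≤ c → s j c = 0) →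
      ∀ j, (∀ t, g j t ⬝ᵥ tx t g s = 0) → ∀ c < a j, s j c = 0

theorem Delivers.exists_strategy {n : ℕ} {a : Fin k → ℕ} (h : Delivers m I μ n a) :
    ∃ f : Strategy k m n I, f.dim = a ∧ f.Decodable μ := by
  obtain ⟨tx, hmeas, hcausal, hdec⟩ := h
  let ι : ((i : Fin k) → Fin (a i) → ℂ) →ₗ[ℂ] Symbols k :=
    { toFun := fun x j c => if h : c < a j then x j ⟨c, h⟩ else 0
      map_add' := fun x y => by funext j c; by_cases h : c < a j <;> simp [h]
      map_smul' := fun r x => by funext j c; by_cases h : c < a j <;> simp [h] }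
  let f : Strategy k m n I :=
    { dim := a
      pre := fun j t g => Matrix.of fun b c => tx t g (ι (Pi.single j (Pi.single c 1))) b
      meas := fun j t b c => (measurable_pi_apply b).comp (hmeas t _)
      causal := fun j t g g' h1 h2 => by rw [hcausal t g g' h1 h2] }
  refine ⟨f, rfl, (f.decodable_iff μ).mpr fun j => ?_⟩
  have hf : ∀ t g x, f.tx t g x = tx t g (ι x) := by
    intro t g x
    have hx : x = ∑ i, ∑ c, x i c • (Pi.single i (Pi.single c 1) : (i : Fin k) → Fin (a i) → ℂ) := by
      funext i c
      simp only [Finset.sum_apply, Pi.smul_apply]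
      rw [Finset.sum_eq_single i, Finset.sum_eq_single c]
      · simp
      · intro c' _ hc'; simp [hc'.symm]
      · simp
      · intro i' _ hi'; simp [hi'.symm]
      · simp
    conv_rhs => rw [hx]
    rw [f.tx_apply]
    simp only [map_sum, map_smul]
    refine Finset.sum_congr rfl fun i _ => ?_
    funext b
    simp only [mulVec, dotProduct, f, Matrix.of_apply, Finset.sum_apply, Pi.smul_apply, smul_eq_mul]
    exact Finset.sum_congr rfl fun c _ => mul_comm _ _
  filter_upwards [hdec] with g hg x hx
  funext c
  have := hg (ι x) (fun j c hc => dif_neg (by omega)) j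
    (fun t => by rw [← hf]; exact hx t) c c.2
  rwa [show ι x j c = x j c from dif_pos c.2] at this

theorem Delivers.mono {n : ℕ} {a a' : Fin k → ℕ} (h : Delivers m I μ n a) (ha : a' ≤ a) :
    Delivers m I μ n a' := by
  obtain ⟨tx, h1, h2, h3⟩ := h
  refine ⟨tx, h1, h2, ?_⟩
  filter_upwards [h3] with g hg s hs j hj c hc
  exact hg s (fun j c hc => hs j c ((ha j).trans hc)) j hj c (hc.trans_le (ha j))

theorem Delivers.zero (n : ℕ) : Delivers m I μ n 0 :=
  ⟨fun _ _ => 0, fun _ _ => measurable_const, fun _ _ _ _ _ => rfl,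
    Eventually.of_forall fun _ _ _ _ _ _ hc => absurd hc (Nat.not_lt_zero _)⟩

variable [IsProbabilityMeasure μ]

theorem measurePreserving_comp_injective {ι κ X : Type*} [Fintype ι] [Fintype κ]
    [MeasurableSpace X] (ν : Measure X) [IsProbabilityMeasure ν] {e : ι → κ}
    (he : Function.Injective e) :
    MeasurePreserving (fun x : κ → X => x ∘ e) (Measure.pi fun _ => ν) (Measure.pi fun _ => ν) := by
  classical
  have hm : Measurable fun x : κ → X => x ∘ e :=
    measurable_pi_lambda _ fun i => measurable_pi_apply _
  refine ⟨hm, (Measure.pi_eq fun s hs => ?_).symm⟩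
  rw [Measure.map_apply hm (MeasurableSet.univ_pi hs)]
  have : (fun x : κ → X => x ∘ e) ⁻¹' Set.univ.pi s =
      Set.univ.pi fun c => ⋂ i ∈ {i | e i = c}, s i := by
    ext x
    simp only [Set.mem_preimage, Set.mem_univ_pi, Function.comp_apply, Set.mem_iInter]
    exact ⟨fun h c i hi => by rw [← show e i = c from hi]; exact h i, fun h i => h (e i) i rfl⟩
  rw [this, Measure.pi_pi]
  have h1 : ∀ i, ⋂ i' ∈ {i' | e i' = e i}, s i' = s i := by
    intro i
    ext x
    simp only [Set.mem_iInter, Set.mem_ofPred_eq]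
    exact ⟨fun h => h i rfl, fun h i' hi' => by rwa [he hi']⟩
  rw [← Finset.prod_subset (Finset.subset_univ (Finset.univ.image e)),
    Finset.prod_image fun i _ i' _ h => he h]
  · simp only [h1]
  · intro c _ hc
    have : ∀ i, e i ≠ c := fun i h => hc (Finset.mem_image.mpr ⟨i, Finset.mem_univ i, h⟩)
    simp [this]

/-- Restriction of the channel to some of the time slots. -/
def restrictSlots {n n' : ℕ} (e : Fin n → Fin n') (g : Chan k m n') : Chan k m n :=
  fun j t => g j (e t)

theorem measurePreserving_restrictSlots {n n' : ℕ} {e : Fin n → Fin n'}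
    (he : Function.Injective e) :
    MeasurePreserving (restrictSlots (k := k) (m := m) e) (chanMeasure k m n' μ)
      (chanMeasure k m n μ) :=
  measurePreserving_pi _ _ fun _ => measurePreserving_comp_injective _ he

theorem Delivers.add {n n' : ℕ} {a a' : Fin k → ℕ} (h : Delivers m I μ n a)
    (h' : Delivers m I μ n' a') : Delivers m I μ (n + n') (a + a') := by
  obtain ⟨tx, h1, h2, h3⟩ := h
  obtain ⟨tx', h1', h2', h3'⟩ := h'
  let S : Symbols k →ₗ[ℂ] Symbols k :=
    { toFun := fun s j c => if c < a j then s j c else 0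
      map_add' := fun x y => by funext j c; by_cases h : c < a j <;> simp [h]
      map_smul' := fun r x => by funext j c; by_cases h : c < a j <;> simp [h] }
  let S' : Symbols k →ₗ[ℂ] Symbols k :=
    { toFun := fun s j c => s j (a j + c)
      map_add' := fun x y => rfl
      map_smul' := fun r x => rfl }
  have hm := measurePreserving_restrictSlots (k := k) (m := m) (μ := μ)
    (Fin.castAdd_injective n n')
  have hm' := measurePreserving_restrictSlots (k := k) (m := m) (μ := μ)
    (Fin.natAdd_injective n' n)
  refine ⟨fun t g => Fin.addCases
    (fun t => tx t (restrictSlots (Fin.castAdd n') g) ∘ₗ S)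
    (fun t => tx' t (restrictSlots (Fin.natAdd n) g) ∘ₗ S') t, ?_, ?_, ?_⟩
  · intro t s
    induction t using Fin.addCases with
    | left t => simpa [Function.comp_def] using (h1 t (S s)).comp hm.measurable
    | right t => simpa [Function.comp_def] using (h1' t (S' s)).comp hm'.measurable
  · intro t g g' hP hD
    induction t using Fin.addCases with
    | left t =>
      simp only [Fin.addCases_left]
      rw [h2 t (restrictSlots (Fin.castAdd n') g) (restrictSlots (Fin.castAdd n') g')
        (fun i hi s hs => hP i hi (Fin.castAdd n' s) (by simpa using hs))
        (fun i hi s hs => hD i hi (Fin.castAdd n' s) (by simpa using hs))]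
    | right t =>
      simp only [Fin.addCases_right]
      rw [h2' t (restrictSlots (Fin.natAdd n) g) (restrictSlots (Fin.natAdd n) g')
        (fun i hi s hs => hP i hi (Fin.natAdd n s) (by simpa using hs))
        (fun i hi s hs => hD i hi (Fin.natAdd n s) (by simpa using hs))]
  · filter_upwards [hm.quasiMeasurePreserving.ae h3, hm'.quasiMeasurePreserving.ae h3']
      with g hg hg' s hs j hj c hc
    by_cases hca : c < a j
    · have := hg (S s) (fun j c hc => if_neg (by omega)) j
        (fun t => by simpa [restrictSlots] using hj (Fin.castAdd n' t)) c hca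
      simpa [S, hca] using this
    · have := hg' (S' s) (fun j c hc => hs j _ (by simpa using hc)) j
        (fun t => by simpa [restrictSlots] using hj (Fin.natAdd n t)) (c - a j)
        (by simp only [Pi.add_apply] at hc; omega)
      simpa [S', Nat.add_sub_cancel' (not_lt.mp hca)] using this

theorem Delivers.nsmul {n : ℕ} {a : Fin k → ℕ} (h : Delivers m I μ n a) (c : ℕ) :
    Delivers m I μ (c * n) (c • a) := by
  induction c with
  | zero => simpa using Delivers.zero _
  | succ c ih =>
    rw [Nat.succ_mul, succ_nsmul]
    exact ih.add h

theorem Delivers.sum {ι : Type*} (T : Finset ι) {n : ι → ℕ} {a : ι → Fin k → ℕ}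
    (h : ∀ i ∈ T, Delivers m I μ (n i) (a i)) :
    Delivers m I μ (∑ i ∈ T, n i) (∑ i ∈ T, a i) := by
  classical
  induction T using Finset.induction_on with
  | empty => simpa using Delivers.zero _
  | insert i T hi ih =>
    rw [Finset.sum_insert hi, Finset.sum_insert hi]
    exact (h i (Finset.mem_insert_self i T)).add
      (ih fun j hj => h j (Finset.mem_insert_of_mem hj))

/-- The rates `v` are delivered exactly by a scheme of finite block length. -/
def DeliversRate (m : ℕ) (I : Fin k → CSITState) (μ : Measure ℂ) (v : Fin k → ℝ) : Prop :=
  ∃ (n : ℕ) (a : Fin k → ℕ), 0 < n ∧ Delivers m I μ n a ∧ ∀ j, v j = a j / n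

/-- Time sharing between schemes of finite block length. -/
theorem linAchievable_of_deliversRate {ι : Type*} [Fintype ι] {v : ι → Fin k → ℝ}
    (hv : ∀ i, DeliversRate m I μ (v i)) {w : ι → ℝ} (hw : ∀ i, 0 ≤ w i) (hw1 : ∑ i, w i ≤ 1)
    {d : Fin k → ℝ} (hd : ∀ j, 0 ≤ d j ∧ d j ≤ 1) (hdv : ∀ j, d j ≤ ∑ i, w i * v i j) :
    LinAchievable k m I μ d := by
  choose N a hN hA hva using hv
  refine ⟨hd, ?_⟩
  let c (n : ℕ) (i : ι) : ℕ := ⌊w i / N i * n⌋₊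
  let b (n : ℕ) (j : Fin k) : ℕ := min ⌊d j * n⌋₊ (∑ i, c n i * a i j)
  have hN' : ∀ i, (0 : ℝ) < N i := fun i => by exact_mod_cast hN i
  have hc : ∀ n, ∑ i, c n i * N i ≤ n := by
    intro n
    have : (∑ i, (c n i : ℝ) * N i) ≤ n := by
      calc ∑ i, (c n i : ℝ) * N i ≤ ∑ i, w i / N i * n * N i := by
            refine Finset.sum_le_sum fun i _ => mul_le_mul_of_nonneg_right ?_ (hN' i).le
            exact Nat.floor_le (mul_nonneg (div_nonneg (hw i) (hN' i).le) (Nat.cast_nonneg n))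
        _ = (∑ i, w i) * n := by
            rw [Finset.sum_mul]
            refine Finset.sum_congr rfl fun i _ => ?_
            have := (hN' i).ne'
            field_simp
        _ ≤ n := by nlinarith [(Nat.cast_nonneg n : (0 : ℝ) ≤ n)]
    exact_mod_cast this
  have hb : ∀ n, Delivers m I μ n (b n) := by
    intro n
    have h1 := (Delivers.sum Finset.univ fun i _ => (hA i).nsmul (c n i)).add
      (Delivers.zero (n - ∑ i, c n i * N i))
    rw [Nat.add_sub_cancel' (hc n)] at h1
    refine h1.mono fun j => (min_le_right _ _).trans (le_of_eq ?_)
    simp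
  choose F hF1 hF2 using fun n => (hb n).exists_strategy
  refine ⟨F, hF2, fun j => ?_⟩
  have hfl : ∀ r : ℝ, 0 ≤ r → Tendsto (fun n : ℕ => (⌊r * n⌋₊ : ℝ) / n) atTop (𝓝 r) :=
    fun r hr => (tendsto_nat_floor_mul_div_atTop hr).comp tendsto_natCast_atTop_atTop
  have h2 : Tendsto (fun n : ℕ => ∑ i, (c n i : ℝ) / n * a i j) atTop
      (𝓝 (∑ i, w i / N i * a i j)) :=
    tendsto_finsetSum _ fun i _ => (hfl _ (div_nonneg (hw i) (hN' i).le)).mul_const _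
  have h3 : d j = min (d j) (∑ i, w i / N i * a i j) := by
    refine (min_eq_left ((hdv j).trans (le_of_eq ?_))).symm
    refine Finset.sum_congr rfl fun i _ => ?_
    rw [hva]
    ring
  rw [h3]
  refine ((hfl _ (hd j).1).min h2).congr fun n => ?_
  rw [hF1]
  simp only [b]
  push_cast
  rw [← min_div_div_right (Nat.cast_nonneg n), Finset.sum_div]
  congr 1
  refine Finset.sum_congr rfl fun i _ => by ring

end Achievability

section Achievability

variable {k m : ℕ} {I : Fin k → CSITState} {μ : Measure ℂ} [IsProbabilityMeasure μ]

/-- Additional transmit antennas can be switched off. -/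
theorem Delivers.of_le {m' n : ℕ} (hm : m ≤ m') {a : Fin k → ℕ} (h : Delivers m I μ n a) :
    Delivers m' I μ n a := by
  obtain ⟨tx, h1, h2, h3⟩ := h
  let e : Fin m → Fin m' := Fin.castLE hm
  have he : Function.Injective e := Fin.castLE_injective hm
  let R (g : Chan k m' n) : Chan k m n := fun j t => g j t ∘ e
  have hR : MeasurePreserving R (chanMeasure k m' n μ) (chanMeasure k m n μ) :=
    measurePreserving_pi _ _ fun _ => measurePreserving_pi _ _ fun _ =>
      measurePreserving_comp_injective _ he
  have hdot : ∀ (v : Fin m' → ℂ) (w : Fin m → ℂ),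
      v ⬝ᵥ Function.extend e w 0 = (v ∘ e) ⬝ᵥ w := by
    intro v w
    refine (Fintype.sum_of_injective e he _ _ (fun a ha => ?_) (fun i => ?_)).symm
    · rw [Function.extend_apply' _ _ _ (by simpa using ha)]
      simp
    · rw [he.extend_apply]
      rfl
  refine ⟨fun t g => Function.ExtendByZero.linearMap ℂ e ∘ₗ tx t (R g), ?_, ?_, ?_⟩
  · intro t s
    refine measurable_pi_lambda _ fun a => ?_
    change Measurable fun g => Function.extend e (tx t (R g) s) 0 a
    by_cases ha : ∃ i, e i = a
    · obtain ⟨i, rfl⟩ := ha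
      simp only [he.extend_apply]
      exact (measurable_pi_apply i).comp ((h1 t s).comp hR.measurable)
    · simp only [Function.extend_apply' _ _ _ ha]
      exact measurable_const
  · intro t g g' hP hD
    simp only
    rw [h2 t (R g) (R g') (fun i hi s hs => by simp only [R, hP i hi s hs])
      (fun i hi s hs => by simp only [R, hD i hi s hs])]
  · filter_upwards [hR.quasiMeasurePreserving.ae h3] with g hg s hs j hj
    refine hg s hs j fun t => ?_
    rw [← hj t]
    exact (hdot _ _).symm

variable {n : ℕ}

/-- The signal sending `x`, `y`, `z` over the three antennas. -/
def antennas (x y z : Symbols k →ₗ[ℂ] ℂ) : Symbols k →ₗ[ℂ] (Fin 3 → ℂ) :=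
  LinearMap.pi ![x, y, z]

/-- The `c`-th information symbol of receiver `j`. -/
def sym (j : Fin k) (c : ℕ) : Symbols k →ₗ[ℂ] ℂ := LinearMap.proj c ∘ₗ LinearMap.proj j

@[simp] theorem sym_apply (j : Fin k) (c : ℕ) (s : Symbols k) : sym j c s = s j c := rfl

@[simp] theorem dotProduct_antennas (v : Fin 3 → ℂ) (x y z : Symbols k →ₗ[ℂ] ℂ) (s : Symbols k) :
    v ⬝ᵥ antennas x y z s = v 0 * x s + v 1 * y s + v 2 * z s := by
  simp [antennas, dotProduct, Fin.sum_univ_three]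

theorem measurable_antennas {x y z : Chan k 3 n → Symbols k →ₗ[ℂ] ℂ} {s : Symbols k}
    (hx : Measurable fun g => x g s) (hy : Measurable fun g => y g s)
    (hz : Measurable fun g => z g s) :
    Measurable fun g => antennas (x g) (y g) (z g) s := by
  refine measurable_pi_lambda _ fun a => ?_
  fin_cases a
  · exact hx
  · exact hy
  · exact hz

/-- A `2 × 2` minor of channel vectors. -/
def minor (v w : Fin 3 → ℂ) (a b : Fin 3) : ℂ := v a * w b - v b * w a

/-- The determinant of three channel vectors. -/
def det₃ (u v w : Fin 3 → ℂ) : ℂ :=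
  u 0 * (v 1 * w 2 - v 2 * w 1) - u 1 * (v 0 * w 2 - v 2 * w 0) + u 2 * (v 0 * w 1 - v 1 * w 0)

/-- General position of the channel vectors. -/
structure GeneralPosition (g : Chan k 3 n) : Prop where
  coef : ∀ j t a, g j t a ≠ 0
  minor : ∀ i t j s a b, (i ≠ j ∨ t ≠ s) → a ≠ b → minor (g i t) (g j s) a b ≠ 0
  det : ∀ i j l t, i ≠ j → j ≠ l → i ≠ l → det₃ (g i t) (g j t) (g l t) ≠ 0

theorem ae_generalPosition [NullSingletonClass μ] :
    ∀ᵐ g ∂chanMeasure k 3 n μ, GeneralPosition g := by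
  have hc : ∀ (j : Fin k) (t : Fin n) (a : Fin 3), SepPoly fun g : Chan k 3 n => g j t a :=
    SepPoly.coord
  have h1 : ∀ᵐ g ∂chanMeasure k 3 n μ, ∀ j t a, g j t a ≠ 0 := by
    simp only [ae_all_iff]
    exact fun j t a => (hc j t a).ae_ne_zero (fun _ _ _ => 1) one_ne_zero
  have h2 : ∀ᵐ g ∂chanMeasure k 3 n μ, ∀ i t j s a b, (i ≠ j ∨ t ≠ s) → a ≠ b →
      _root_.minor (g i t) (g j s) a b ≠ 0 := by
    simp only [ae_all_iff]
    intro i t j s a b h hab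
    refine (((hc i t a).mul (hc j s b)).sub ((hc i t b).mul (hc j s a))).ae_ne_zero
      (fun i' t' c => if i' = i ∧ t' = t then (if c = a then 1 else 0)
        else (if c = b then 1 else 0)) ?_
    have : ¬(j = i ∧ s = t) := by
      rintro ⟨rfl, rfl⟩
      simp at h
    simp [this, hab, hab.symm]
  have h3 : ∀ᵐ g ∂chanMeasure k 3 n μ, ∀ i j l t, i ≠ j → j ≠ l → i ≠ l →
      det₃ (g i t) (g j t) (g l t) ≠ 0 := by
    simp only [ae_all_iff]
    intro i j l t hij hjl hil
    have hm : ∀ a b, SepPoly fun g : Chan k 3 n => g j t a * g l t b - g j t b * g l t a :=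
      fun a b => ((hc j t a).mul (hc l t b)).sub ((hc j t b).mul (hc l t a))
    refine ((((hc i t 0).mul (hm 1 2)).sub ((hc i t 1).mul (hm 0 2))).add
      ((hc i t 2).mul (hm 0 1))).ae_ne_zero
      (fun i' _ c => if i' = i then (if c = 0 then 1 else 0)
        else if i' = j then (if c = 1 then 1 else 0) else (if c = 2 then 1 else 0)) ?_
    simp [hij.symm, hjl.symm, hil.symm]
  filter_upwards [h1, h2, h3] with g h1 h2 h3
  exact ⟨h1, h2, h3⟩

theorem eq_zero_of_minor {a b c d x y : ℂ} (h : a * d - b * c ≠ 0) (h1 : a * x + b * y = 0)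
    (h2 : c * x + d * y = 0) : x = 0 ∧ y = 0 := by
  constructor
  · refine (mul_eq_zero.mp (?_ : (a * d - b * c) * x = 0)).resolve_left h
    linear_combination d * h1 - b * h2
  · refine (mul_eq_zero.mp (?_ : (a * d - b * c) * y = 0)).resolve_left h
    linear_combination a * h2 - c * h1

theorem eq_zero_of_det₃ {u v w : Fin 3 → ℂ} (h : det₃ u v w ≠ 0) {x y z : ℂ}
    (h1 : u 0 * x + u 1 * y + u 2 * z = 0) (h2 : v 0 * x + v 1 * y + v 2 * z = 0)
    (h3 : w 0 * x + w 1 * y + w 2 * z = 0) : x = 0 ∧ y = 0 ∧ z = 0 := by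
  refine ⟨?_, ?_, ?_⟩
  · refine (mul_eq_zero.mp (?_ : det₃ u v w * x = 0)).resolve_left h
    unfold det₃
    linear_combination (v 1 * w 2 - v 2 * w 1) * h1 - (u 1 * w 2 - u 2 * w 1) * h2
      + (u 1 * v 2 - u 2 * v 1) * h3
  · refine (mul_eq_zero.mp (?_ : det₃ u v w * y = 0)).resolve_left h
    unfold det₃
    linear_combination -(v 0 * w 2 - v 2 * w 0) * h1 + (u 0 * w 2 - u 2 * w 0) * h2
      - (u 0 * v 2 - u 2 * v 0) * h3
  · refine (mul_eq_zero.mp (?_ : det₃ u v w * z = 0)).resolve_left h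
    unfold det₃
    linear_combination (v 0 * w 1 - v 1 * w 0) * h1 - (u 0 * w 1 - u 1 * w 0) * h2
      + (u 0 * v 1 - u 1 * v 0) * h3

/-- A scheme over three antennas that decodes in general position. -/
theorem Delivers.of_generalPosition [NullSingletonClass μ] (hm : 3 ≤ m) {a : Fin k → ℕ}
    (x y z : Fin n → Chan k 3 n → Symbols k →ₗ[ℂ] ℂ)
    (hmeas : ∀ t s, (Measurable fun g => x t g s) ∧ (Measurable fun g => y t g s) ∧
      Measurable fun g => z t g s)
    (hcausal : Causal I fun t g => (x t g, y t g, z t g))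
    (hdec : ∀ g, GeneralPosition g → ∀ s : Symbols k, ∀ j,
      (∀ t, g j t 0 * x t g s + g j t 1 * y t g s + g j t 2 * z t g s = 0) →
        ∀ c < a j, s j c = 0) : Delivers m I μ n a := by
  refine Delivers.of_le hm ⟨fun t g => antennas (x t g) (y t g) (z t g), ?_, ?_, ?_⟩
  · exact fun t s => measurable_antennas (hmeas t s).1 (hmeas t s).2.1 (hmeas t s).2.2
  · intro t g g' hP hD
    have := hcausal t g g' hP hD
    simp only [Prod.mk.injEq] at this
    simp only [this]
  · filter_upwards [ae_generalPosition] with g hg s _ j hj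
    exact hdec g hg s j fun t => by simpa using hj t

end Achievability

section Schemes

variable {k m : ℕ} {I : Fin k → CSITState} {μ : Measure ℂ} [IsProbabilityMeasure μ]
  [NullSingletonClass μ]

theorem delivers_single (hm : 3 ≤ m) (p : Fin k) :
    Delivers m I μ 1 fun j => if j = p then 1 else 0 := by
  refine Delivers.of_generalPosition hm (fun _ _ => sym p 0) 0 0 ?_ ?_ ?_
  · intro t s
    simp
  · intro t g g' hP hD
    rfl
  · intro g hg s j h c hc
    have h0 := h 0
    simp at h0
    by_cases hj : j = p
    · subst hj
      simp at hc
      simpa [hc, hg.coef] using h0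
    · simp [hj] at hc

theorem delivers_PP (hm : 3 ≤ m) {p q : Fin k} (hp : I p = CSITState.P) (hq : I q = CSITState.P)
    (hpq : p ≠ q) : Delivers m I μ 1 fun j => if j = p then 1 else if j = q then 1 else 0 := by
  refine Delivers.of_generalPosition hm (fun t g => g q t 1 • sym p 0 + g p t 1 • sym q 0)
    (fun t g => -g q t 0 • sym p 0 - g p t 0 • sym q 0) 0 ?_ ?_ ?_
  · intro t s
    simp only [LinearMap.add_apply, LinearMap.sub_apply, LinearMap.smul_apply, Pi.zero_apply,
      LinearMap.zero_apply, smul_eq_mul]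
    refine ⟨?_, ?_, ?_⟩ <;> fun_prop
  · intro t g g' hP hD
    simp only [hP p hp t le_rfl, hP q hq t le_rfl, Pi.zero_apply]
  · intro g hg s j h c hc
    have h0 := h 0
    have hd := hg.minor p 0 q 0 0 1 (Or.inl hpq) (by decide)
    unfold minor at hd
    simp at h0
    by_cases hj : j = p
    · subst hj
      simp at hc
      subst hc
      refine (mul_eq_zero.mp ?_).resolve_left hd
      linear_combination h0
    · by_cases hj' : j = q
      · subst hj'
        simp [hj] at hc
        subst hc
        refine (mul_eq_zero.mp ?_).resolve_left hd
        linear_combination -h0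
      · simp [hj, hj'] at hc

theorem delivers_PD (hm : 3 ≤ m) {p q : Fin k} (hp : I p = CSITState.P) (hq : I q = CSITState.D)
    (hpq : p ≠ q) : Delivers m I μ 2 fun j => if j = p then 2 else if j = q then 1 else 0 := by
  refine Delivers.of_generalPosition hm
    (fun t g => ![sym p 0 + g p 0 1 • sym q 0, g q 0 0 • sym p 0 + g q 0 1 • sym p 1] t)
    (fun t g => ![sym p 1 - g p 0 0 • sym q 0, 0] t) 0 ?_ ?_ ?_
  · intro t s
    fin_cases t <;> simp <;> (try constructor) <;> fun_prop
  · intro t g g' hP hD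
    have hP := hP p hp
    have hD := hD q hq
    fin_cases t <;> simp [hP, hD]
  · intro g hg s j h c hc
    have h0 := h 0
    have h1 := h 1
    have hd := hg.minor p 0 q 0 0 1 (Or.inl hpq) (by decide)
    unfold minor at hd
    simp [hg.coef] at h0 h1
    by_cases hj : j = p
    · subst hj
      simp at hc
      have := eq_zero_of_minor hd (x := s j 0) (y := s j 1) (by linear_combination h0) h1
      interval_cases c
      exacts [this.1, this.2]
    · by_cases hj' : j = q
      · subst hj'
        simp [hj] at hc
        subst hc
        refine (mul_eq_zero.mp ?_).resolve_left hd
        linear_combination h1 - h0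
      · simp [hj, hj'] at hc

end Schemes

section ThreeUserSchemes

variable {k m : ℕ} {I : Fin k → CSITState} {μ : Measure ℂ} [IsProbabilityMeasure μ]
  [NullSingletonClass μ]

/-- The numbers of symbols `a`, `b`, `c` for the receivers `p`, `q`, `r`, and none for others. -/
def triple {α : Type*} [Zero α] (p q r : Fin k) (a b c : α) : Fin k → α :=
  fun j => if j = p then a else if j = q then b else if j = r then c else 0

/-- What a receiver with channel vector `v` gets when `x`, `y`, `z` are sent. -/
def observe (v : Fin 3 → ℂ) (x y z : Symbols k →ₗ[ℂ] ℂ) : Symbols k →ₗ[ℂ] ℂ :=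
  v 0 • x + v 1 • y + v 2 • z

@[simp] theorem observe_apply (v : Fin 3 → ℂ) (x y z : Symbols k →ₗ[ℂ] ℂ) (s : Symbols k) :
    observe v x y z s = v 0 * x s + v 1 * y s + v 2 * z s := rfl

theorem Delivers.of_generalPosition_triple {n : ℕ} (hm : 3 ≤ m) {p q r : Fin k} {a b c : ℕ}
    (x y z : Fin n → Chan k 3 n → Symbols k →ₗ[ℂ] ℂ)
    (hmeas : ∀ t s, (Measurable fun g => x t g s) ∧ (Measurable fun g => y t g s) ∧
      Measurable fun g => z t g s)
    (hcausal : Causal I fun t g => (x t g, y t g, z t g))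
    (hdec : ∀ g, GeneralPosition g → ∀ s : Symbols k,
      ((∀ t, g p t 0 * x t g s + g p t 1 * y t g s + g p t 2 * z t g s = 0) →
        ∀ i < a, s p i = 0) ∧
      ((∀ t, g q t 0 * x t g s + g q t 1 * y t g s + g q t 2 * z t g s = 0) →
        ∀ i < b, s q i = 0) ∧
      ((∀ t, g r t 0 * x t g s + g r t 1 * y t g s + g r t 2 * z t g s = 0) →
        ∀ i < c, s r i = 0)) : Delivers m I μ n (triple p q r a b c) := by
  refine Delivers.of_generalPosition hm x y z hmeas hcausal fun g hg s j h i hi => ?_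
  obtain ⟨h1, h2, h3⟩ := hdec g hg s
  unfold triple at hi
  split_ifs at hi with e1 e2 e3
  · subst e1
    exact h1 h i hi
  · subst e2
    exact h2 h i hi
  · subst e3
    exact h3 h i hi
  · exact absurd hi (Nat.not_lt_zero _)

theorem delivers_PPP (hm : 3 ≤ m) {p q r : Fin k} (hp : I p = CSITState.P)
    (hq : I q = CSITState.P) (hr : I r = CSITState.P) (hpq : p ≠ q) (hqr : q ≠ r) (hpr : p ≠ r) :
    Delivers m I μ 1 (triple p q r 1 1 1) := by
  let tx (a b : Fin 3) (t : Fin 1) (g : Chan k 3 1) : Symbols k →ₗ[ℂ] ℂ :=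
    minor (g q t) (g r t) a b • sym p 0 + minor (g r t) (g p t) a b • sym q 0 +
      minor (g p t) (g q t) a b • sym r 0
  refine Delivers.of_generalPosition_triple hm (tx 1 2) (tx 2 0) (tx 0 1) ?_ ?_ ?_
  · intro t s
    simp only [tx, minor, LinearMap.add_apply, LinearMap.smul_apply, smul_eq_mul]
    refine ⟨?_, ?_, ?_⟩ <;> fun_prop
  · intro t g g' hP hD
    simp only [tx, hP p hp t le_rfl, hP q hq t le_rfl, hP r hr t le_rfl]
  · intro g hg s
    have hd := hg.det p q r 0 hpq hqr hpr
    refine ⟨?_, ?_, ?_⟩ <;> intro h i hi <;> have h := h 0 <;> simp [tx] at h <;>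
      rw [Nat.lt_one_iff] at hi <;> subst hi <;>
      refine (mul_eq_zero.mp ?_).resolve_left hd <;> simp only [det₃, minor] at h ⊢ <;>
      linear_combination h

theorem delivers_DD (hm : 3 ≤ m) {p q : Fin k} (hp : I p = CSITState.D)
    (hq : I q = CSITState.D) (hpq : p ≠ q) :
    Delivers m I μ 3 fun j => if j = p then 2 else if j = q then 2 else 0 := by
  refine Delivers.of_generalPosition hm
    (fun t g => ![sym p 0, sym q 0, observe (g q 0) (sym p 0) (sym p 1) 0 +
      observe (g p 1) (sym q 0) (sym q 1) 0] t)
    (fun t g => ![sym p 1, sym q 1, 0] t) 0 ?_ ?_ ?_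
  · intro t s
    fin_cases t <;> simp <;> fun_prop
  · intro t g g' hP hD
    have hDp := hD p hp
    have hDq := hD q hq
    fin_cases t <;> simp [hDp, hDq]
  · intro g hg s j h c hc
    have h0 := h 0
    have h1 := h 1
    have h2 := h 2
    simp [hg.coef] at h0 h1 h2
    have hd0 := hg.minor p 0 q 0 0 1 (Or.inl hpq) (by decide)
    have hd1 := hg.minor p 1 q 1 0 1 (Or.inl hpq) (by decide)
    unfold minor at hd0 hd1
    by_cases hj : j = p
    · subst hj
      simp at hc
      have := eq_zero_of_minor hd0 h0 (by linear_combination h2 - h1)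
      interval_cases c
      exacts [this.1, this.2]
    · by_cases hj' : j = q
      · subst hj'
        simp [hj] at hc
        have := eq_zero_of_minor hd1 (x := s j 0) (y := s j 1) (by linear_combination h2 - h0) h1
        interval_cases c
        exacts [this.1, this.2]
      · simp [hj, hj'] at hc

end ThreeUserSchemes

section LongerSchemes

variable {k m : ℕ} {I : Fin k → CSITState} {μ : Measure ℂ} [IsProbabilityMeasure μ]
  [NullSingletonClass μ]

/-- Two symbols `x`, `y` beamformed so that the receiver with channel vector `u` hears nothing
are determined by what two other receivers hear. -/
theorem eq_zero_of_nulled {u v w : Fin 3 → ℂ} (hu : u 0 ≠ 0) (h : det₃ u v w ≠ 0) {x y : ℂ}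
    (h1 : v 0 * (u 1 * x + u 2 * y) - v 1 * (u 0 * x) - v 2 * (u 0 * y) = 0)
    (h2 : w 0 * (u 1 * x + u 2 * y) - w 1 * (u 0 * x) - w 2 * (u 0 * y) = 0) :
    x = 0 ∧ y = 0 := by
  obtain ⟨-, h3, h4⟩ := eq_zero_of_det₃ h (x := u 1 * x + u 2 * y) (y := -(u 0 * x))
    (z := -(u 0 * y)) (by ring) (by linear_combination h1) (by linear_combination h2)
  simpa [hu] using And.intro h3 h4

theorem delivers_PPD (hm : 3 ≤ m) {p q r : Fin k} (hp : I p = CSITState.P)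
    (hq : I q = CSITState.P) (hr : I r = CSITState.D) (hpq : p ≠ q) (hqr : q ≠ r) (hpr : p ≠ r) :
    Delivers m I μ 4 (triple p q r 4 4 1) := by
  let L (t : Fin 4) (a b : ℕ) (g : Chan k 3 4) : Symbols k →ₗ[ℂ] ℂ :=
    observe (g r t) (g q t 1 • sym p a + g q t 2 • sym p b) (-(g q t 0 • sym p a))
      (-(g q t 0 • sym p b))
  let M (t : Fin 4) (a b : ℕ) (g : Chan k 3 4) : Symbols k →ₗ[ℂ] ℂ :=
    observe (g r t) (g p t 1 • sym q a + g p t 2 • sym q b) (-(g p t 0 • sym q a))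
      (-(g p t 0 • sym q b))
  let c (g : Chan k 3 4) : ℂ := minor (g r 2) (g q 2) 0 1
  let e (g : Chan k 3 4) : ℂ := minor (g r 2) (g p 2) 0 1
  let L' (g : Chan k 3 4) : Symbols k →ₗ[ℂ] ℂ := c g • L 0 0 1 g - e g • L 1 2 3 g
  let M' (g : Chan k 3 4) : Symbols k →ₗ[ℂ] ℂ := c g • M 0 0 1 g - e g • M 1 2 3 g
  refine Delivers.of_generalPosition_triple hm
    (fun t g => ![g q 0 1 • sym p 0 + g q 0 2 • sym p 1 + g p 0 1 • sym q 0 + g p 0 2 • sym q 1 +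
        minor (g p 0) (g q 0) 1 2 • sym r 0,
      g q 1 1 • sym p 2 + g q 1 2 • sym p 3 + g p 1 1 • sym q 2 + g p 1 2 • sym q 3,
      g q 2 1 • L 0 0 1 g + g p 2 1 • M 1 2 3 g,
      g q 3 1 • L' g + g p 3 1 • M' g] t)
    (fun t g => ![-(g q 0 0 • sym p 0) - g p 0 0 • sym q 0 + minor (g p 0) (g q 0) 2 0 • sym r 0,
      -(g q 1 0 • sym p 2) - g p 1 0 • sym q 2,
      -(g q 2 0 • L 0 0 1 g) - g p 2 0 • M 1 2 3 g,
      -(g q 3 0 • L' g) - g p 3 0 • M' g] t)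
    (fun t g => ![-(g q 0 0 • sym p 1) - g p 0 0 • sym q 1 + minor (g p 0) (g q 0) 0 1 • sym r 0,
      -(g q 1 0 • sym p 3) - g p 1 0 • sym q 3, 0, 0] t) ?_ ?_ ?_
  · intro t s
    fin_cases t <;> simp [L, M, L', M', c, e, minor] <;> (refine ⟨?_, ?_⟩) <;>
      (try refine ⟨?_, ?_⟩) <;> fun_prop
  · intro t g g' hP hD
    have hP1 := hP p hp
    have hP2 := hP q hq
    have hD := hD r hr
    fin_cases t <;> simp [L, M, L', M', c, e, hP1, hP2, hD]
  · intro g hg s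
    have hc : c g ≠ 0 := hg.minor r 2 q 2 0 1 (Or.inl hqr.symm) (by decide)
    have he : e g ≠ 0 := hg.minor r 2 p 2 0 1 (Or.inl hpr.symm) (by decide)
    have hn : ∀ t, minor (g p t) (g q t) 0 1 ≠ 0 := fun t =>
      hg.minor p t q t 0 1 (Or.inl hpq) (by decide)
    refine ⟨?_, ?_, ?_⟩ <;> intro h i hi <;> have h0 := h 0 <;> have h1 := h 1 <;>
      have h2 := h 2 <;> have h3 := h 3 <;>
      simp only [Fin.isValue, Matrix.cons_val, LinearMap.add_apply, LinearMap.sub_apply,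
        LinearMap.neg_apply, LinearMap.smul_apply, smul_eq_mul, LinearMap.zero_apply,
        sym_apply] at h0 h1 h2 h3
    · have hL1 : L 0 0 1 g s = 0 := by
        refine (mul_eq_zero.mp ?_).resolve_left (hn 2)
        unfold minor
        linear_combination h2
      have hL' : L' g s = 0 := by
        refine (mul_eq_zero.mp ?_).resolve_left (hn 3)
        unfold minor
        linear_combination h3
      have hL2 : L 1 2 3 g s = 0 := by
        refine (mul_eq_zero.mp ?_).resolve_left he
        have : L' g s = c g * L 0 0 1 g s - e g * L 1 2 3 g s := rfl
        linear_combination this - hL' + c g * hL1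
      have d0 := eq_zero_of_nulled (hg.coef q 0 0) (hg.det q p r 0 hpq.symm hpr hqr)
        (x := s p 0) (y := s p 1) (by unfold minor at h0; linear_combination h0)
        (by simp [L] at hL1; linear_combination hL1)
      have d1 := eq_zero_of_nulled (hg.coef q 1 0) (hg.det q p r 1 hpq.symm hpr hqr)
        (x := s p 2) (y := s p 3) (by linear_combination h1)
        (by simp [L] at hL2; linear_combination hL2)
      interval_cases i
      exacts [d0.1, d0.2, d1.1, d1.2]
    · have hM2 : M 1 2 3 g s = 0 := by
        refine (mul_eq_zero.mp ?_).resolve_left (hn 2)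
        unfold minor
        linear_combination -h2
      have hM' : M' g s = 0 := by
        refine (mul_eq_zero.mp ?_).resolve_left (hn 3)
        unfold minor
        linear_combination -h3
      have hM1 : M 0 0 1 g s = 0 := by
        refine (mul_eq_zero.mp ?_).resolve_left hc
        have : M' g s = c g * M 0 0 1 g s - e g * M 1 2 3 g s := rfl
        linear_combination hM' - this + e g * hM2
      have d0 := eq_zero_of_nulled (hg.coef p 0 0) (hg.det p q r 0 hpq hqr hpr)
        (x := s q 0) (y := s q 1) (by unfold minor at h0; linear_combination h0)
        (by simp [M] at hM1; linear_combination hM1)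
      have d1 := eq_zero_of_nulled (hg.coef p 1 0) (hg.det p q r 1 hpq hqr hpr)
        (x := s q 2) (y := s q 3) (by linear_combination h1)
        (by simp [M] at hM2; linear_combination hM2)
      interval_cases i
      exacts [d0.1, d0.2, d1.1, d1.2]
    · have e0 : L 0 0 1 g s + M 0 0 1 g s + det₃ (g p 0) (g q 0) (g r 0) * s r 0 = 0 := by
        unfold minor at h0
        simp [L, M, det₃]
        linear_combination h0
      have e1 : L 1 2 3 g s + M 1 2 3 g s = 0 := by
        simp [L, M]
        linear_combination h1
      have e2 : c g * L 0 0 1 g s + e g * M 1 2 3 g s = 0 := by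
        simp only [c, e, minor]
        linear_combination h2
      have e3 : minor (g r 3) (g p 3) 0 1 * M' g s = 0 := by
        have : L' g s = c g * L 0 0 1 g s - e g * L 1 2 3 g s := rfl
        unfold minor
        linear_combination h3 - (g r 3 0 * g q 3 1 - g r 3 1 * g q 3 0) * (this + e2 - e g * e1)
      have e4 := (mul_eq_zero.mp e3).resolve_left
        (hg.minor r 3 p 3 0 1 (Or.inl hpr.symm) (by decide))
      have : M' g s = c g * M 0 0 1 g s - e g * M 1 2 3 g s := rfl
      interval_cases i
      refine (mul_eq_zero.mp ((mul_eq_zero.mp ?_).resolve_left hc)).resolve_left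
        (hg.det p q r 0 hpq hqr hpr)
      linear_combination c g * e0 - e2 - e4 + this

theorem delivers_PDD_three (hm : 3 ≤ m) {p q r : Fin k} (hp : I p = CSITState.P)
    (hq : I q = CSITState.D) (hr : I r = CSITState.D) (hpq : p ≠ q) (hqr : q ≠ r) (hpr : p ≠ r) :
    Delivers m I μ 4 (triple p q r 3 2 2) := by
  let L (j : Fin k) (g : Chan k 3 4) : Symbols k →ₗ[ℂ] ℂ :=
    observe (g j 0) (sym p 0) (sym p 1) (sym p 2)
  let W (j i : Fin k) (t : Fin 4) (g : Chan k 3 4) : Symbols k →ₗ[ℂ] ℂ :=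
    observe (g j t) (g p t 1 • sym i 0 + g p t 2 • sym i 1) (-(g p t 0 • sym i 0))
      (-(g p t 0 • sym i 1))
  refine Delivers.of_generalPosition_triple hm
    (fun t g => ![sym p 0, L r g + g p 1 1 • sym r 0 + g p 1 2 • sym r 1,
      L q g + g p 2 1 • sym q 0 + g p 2 2 • sym q 1,
      g q 1 0 • L r g + W q r 1 g + (g r 2 0 • L q g + W r q 2 g)] t)
    (fun t g => ![sym p 1, -(g p 1 0 • sym r 0), -(g p 2 0 • sym q 0), 0] t)
    (fun t g => ![sym p 2, -(g p 1 0 • sym r 1), -(g p 2 0 • sym q 1), 0] t) ?_ ?_ ?_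
  · intro t s
    fin_cases t <;> simp [L, W] <;> (try refine ⟨?_, ?_⟩) <;>
      (try refine ⟨?_, ?_⟩) <;> fun_prop
  · intro t g g' hP hD
    have hP := hP p hp
    have hD1 := hD q hq
    have hD2 := hD r hr
    fin_cases t <;> simp [L, W, hP, hD1, hD2]
  · intro g hg s
    refine ⟨?_, ?_, ?_⟩ <;> intro h i hi <;> have h0 := h 0 <;> have h1 := h 1 <;>
      have h2 := h 2 <;> have h3 := h 3 <;>
      simp [hg.coef, L, W] at h0 h1 h2 h3
    · have d := eq_zero_of_det₃ (hg.det p q r 0 hpq hqr hpr) (x := s p 0) (y := s p 1)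
        (z := s p 2) h0
        (by refine (mul_eq_zero.mp ?_).resolve_left (hg.coef p 2 0); linear_combination h2)
        (by refine (mul_eq_zero.mp ?_).resolve_left (hg.coef p 1 0); linear_combination h1)
      interval_cases i
      exacts [d.1, d.2.1, d.2.2]
    · have d := eq_zero_of_nulled (hg.coef p 2 0) (hg.det p q r 2 hpq hqr hpr)
        (x := s q 0) (y := s q 1) (by linear_combination h2 - g q 2 0 * h0)
        (by linear_combination h3 - h1 - g r 2 0 * h0)
      interval_cases i
      exacts [d.1, d.2]
    · have d := eq_zero_of_nulled (hg.coef p 1 0) (hg.det p q r 1 hpq hqr hpr)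
        (x := s r 0) (y := s r 1) (by linear_combination h3 - h2 - g q 1 0 * h0)
        (by linear_combination h1 - g r 1 0 * h0)
      interval_cases i
      exacts [d.1, d.2]

theorem delivers_PDD_five (hm : 3 ≤ m) {p q r : Fin k} (hp : I p = CSITState.P)
    (hq : I q = CSITState.D) (hr : I r = CSITState.D) (hpq : p ≠ q) (hqr : q ≠ r) (hpr : p ≠ r) :
    Delivers m I μ 5 (triple p q r 5 2 2) := by
  let L (j : Fin k) (g : Chan k 3 5) : Symbols k →ₗ[ℂ] ℂ :=
    observe (g j 0) (sym p 0) (sym p 1) 0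
  let F (j : Fin k) (g : Chan k 3 5) : Symbols k →ₗ[ℂ] ℂ :=
    observe (g j 1) (sym p 2) (sym p 3) (sym p 4)
  let W (j i : Fin k) (t : Fin 5) (g : Chan k 3 5) : Symbols k →ₗ[ℂ] ℂ :=
    observe (g j t) (g p t 1 • sym i 0 + g p t 2 • sym i 1) (-(g p t 0 • sym i 0))
      (-(g p t 0 • sym i 1))
  let b (g : Chan k 3 5) : ℂ := minor (g q 1) (g p 1) 0 1
  let F' (g : Chan k 3 5) : Symbols k →ₗ[ℂ] ℂ := F q g - b g • L q g
  let Y (g : Chan k 3 5) : Symbols k →ₗ[ℂ] ℂ := g r 3 0 • F' g + W r q 3 g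
  refine Delivers.of_generalPosition_triple hm
    (fun t g => ![sym p 0 + g p 0 1 • sym r 0 + g p 0 2 • sym r 1,
      sym p 2 + g p 1 1 • W q r 0 g, L r g, F' g + g p 3 1 • sym q 0 + g p 3 2 • sym q 1,
      g q 2 0 • L r g + g q 2 1 • F r g + g p 4 1 • Y g] t)
    (fun t g => ![sym p 1 - g p 0 0 • sym r 0, sym p 3 - g p 1 0 • W q r 0 g, F r g,
      -(g p 3 0 • sym q 0), -(g p 4 0 • Y g)] t)
    (fun t g => ![-(g p 0 0 • sym r 1), sym p 4, 0, -(g p 3 0 • sym q 1), 0] t) ?_ ?_ ?_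
  · intro t s
    fin_cases t <;> simp [L, F, W, b, F', Y, minor] <;> (try refine ⟨?_, ?_⟩) <;>
      (try refine ⟨?_, ?_⟩) <;> fun_prop
  · intro t g g' hP hD
    have hP := hP p hp
    have hD1 := hD q hq
    have hD2 := hD r hr
    fin_cases t <;> simp [L, F, W, b, F', Y, hP, hD1, hD2]
  · intro g hg s
    have hF' : F' g s = F q g s - b g * L q g s := rfl
    have hY : Y g s = g r 3 0 * F' g s + W r q 3 g s := rfl
    have hb : b g = g q 1 0 * g p 1 1 - g q 1 1 * g p 1 0 := rfl
    have hL : ∀ j, L j g s = g j 0 0 * s p 0 + g j 0 1 * s p 1 := fun j => by simp [L]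
    have hF : ∀ j, F j g s = g j 1 0 * s p 2 + g j 1 1 * s p 3 + g j 1 2 * s p 4 :=
      fun j => rfl
    have hW : ∀ j i t, W j i t g s = g j t 0 * (g p t 1 * s i 0 + g p t 2 * s i 1) +
      g j t 1 * -(g p t 0 * s i 0) + g j t 2 * -(g p t 0 * s i 1) := fun j i t => rfl
    refine ⟨?_, ?_, ?_⟩ <;> intro h i hi <;> have h0 := h 0 <;> have h1 := h 1 <;>
      have h2 := h 2 <;> have h3 := h 3 <;> have h4 := h 4 <;>
      simp only [Fin.isValue, Matrix.cons_val, LinearMap.add_apply, LinearMap.sub_apply,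
        LinearMap.neg_apply, LinearMap.smul_apply, smul_eq_mul, LinearMap.zero_apply,
        sym_apply] at h0 h1 h2 h3 h4
    · obtain ⟨e1, e2⟩ := eq_zero_of_minor
        (hg.minor p 2 q 2 0 1 (Or.inl hpq) (by decide)) (x := L r g s) (y := F r g s)
        (by linear_combination h2)
        (by refine (mul_eq_zero.mp ?_).resolve_left (hg.coef p 4 0); linear_combination h4)
      have e3 : F' g s = 0 := by
        refine (mul_eq_zero.mp ?_).resolve_left (hg.coef p 3 0)
        linear_combination h3
      obtain ⟨d1, d2⟩ := eq_zero_of_minor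
        (hg.minor p 0 r 0 0 1 (Or.inl hpr) (by decide)) (x := s p 0) (y := s p 1)
        (by linear_combination h0) (by rw [← hL, e1])
      have d := eq_zero_of_det₃ (hg.det p q r 1 hpq hqr hpr) (x := s p 2) (y := s p 3)
        (z := s p 4) (by linear_combination h1)
        (by rw [← hF]; have := hL q; rw [d1, d2] at this; linear_combination e3 - hF' + b g * this)
        (by rw [← hF, e2])
      interval_cases i
      exacts [d1, d2, d.1, d.2.1, d.2.2]
    · have e0 : L q g s + W q r 0 g s = 0 := by
        rw [hL, hW]
        linear_combination h0
      have e1 : F q g s + b g * W q r 0 g s = 0 := by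
        rw [hF, hb]
        linear_combination h1
      have e2 : F' g s = 0 := by linear_combination hF' + e1 - b g * e0
      have e3 : Y g s = 0 := by
        refine (mul_eq_zero.mp ?_).resolve_left
          (hg.minor q 4 p 4 0 1 (Or.inl hpq.symm) (by decide))
        unfold minor
        linear_combination h4 - g q 4 0 * h2
      have e4 := hW r q 3
      have d := eq_zero_of_nulled (hg.coef p 3 0) (hg.det p q r 3 hpq hqr hpr)
        (x := s q 0) (y := s q 1) (by linear_combination h3 - g q 3 0 * e2)
        (by linear_combination e3 - hY - g r 3 0 * e2 - e4)
      interval_cases i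
      exacts [d.1, d.2]
    · have e1 : Y g s = 0 := by
        rw [hY, hW]
        linear_combination h3
      obtain ⟨e2, e3⟩ := eq_zero_of_minor
        (hg.minor q 2 r 2 0 1 (Or.inl hqr) (by decide)) (x := L r g s) (y := F r g s)
        (by
          refine (mul_eq_zero.mp ?_).resolve_left (hg.coef r 4 0)
          linear_combination h4 - (g r 4 0 * g p 4 1 - g r 4 1 * g p 4 0) * e1)
        (by linear_combination h2)
      have e4 : W q r 0 g s = 0 := by
        refine (mul_eq_zero.mp ?_).resolve_left
          (hg.minor r 1 p 1 0 1 (Or.inl hpr.symm) (by decide))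
        rw [hF] at e3
        unfold minor
        linear_combination h1 - e3
      rw [hW] at e4
      rw [hL] at e2
      have d := eq_zero_of_nulled (hg.coef p 0 0) (hg.det p q r 0 hpq hqr hpr)
        (x := s r 0) (y := s r 1) (by linear_combination e4)
        (by linear_combination h0 - e2)
      interval_cases i
      exacts [d.1, d.2]

theorem delivers_DDD (hm : 3 ≤ m) {p q r : Fin k} (hp : I p = CSITState.D)
    (hq : I q = CSITState.D) (hr : I r = CSITState.D) (hpq : p ≠ q) (hqr : q ≠ r) (hpr : p ≠ r) :
    Delivers m I μ 11 (triple p q r 6 6 6) := by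
  let O (j i : Fin k) (t : Fin 11) (c : ℕ) (g : Chan k 3 11) : Symbols k →ₗ[ℂ] ℂ :=
    observe (g j t) (sym i c) (sym i (c + 1)) (sym i (c + 2))
  let AB (g : Chan k 3 11) : Fin 2 → Symbols k →ₗ[ℂ] ℂ :=
    ![O q p 0 0 g + O p q 2 0 g, O q p 1 3 g + O p q 3 3 g]
  let AC (g : Chan k 3 11) : Fin 2 → Symbols k →ₗ[ℂ] ℂ :=
    ![O r p 0 0 g + O p r 4 0 g, O r p 1 3 g + O p r 5 3 g]
  let BC (g : Chan k 3 11) : Fin 2 → Symbols k →ₗ[ℂ] ℂ :=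
    ![O r q 2 0 g + O q r 4 0 g, O r q 3 3 g + O q r 5 3 g]
  let ZC (g : Chan k 3 11) : Symbols k →ₗ[ℂ] ℂ := observe (g r 6) (AB g 0) (AB g 1) 0
  let ZB (g : Chan k 3 11) : Symbols k →ₗ[ℂ] ℂ := observe (g q 7) (AC g 0) (AC g 1) 0
  let ZA (g : Chan k 3 11) : Symbols k →ₗ[ℂ] ℂ := observe (g p 8) (BC g 0) (BC g 1) 0
  refine Delivers.of_generalPosition_triple hm
    (fun t g => ![sym p 0, sym p 3, sym q 0, sym q 3, sym r 0, sym r 3, AB g 0, AC g 0, BC g 0,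
      ZA g, ZA g] t)
    (fun t g => ![sym p 1, sym p 4, sym q 1, sym q 4, sym r 1, sym r 4, AB g 1, AC g 1, BC g 1,
      ZB g, ZB g] t)
    (fun t g => ![sym p 2, sym p 5, sym q 2, sym q 5, sym r 2, sym r 5, 0, 0, 0,
      ZC g, ZC g] t) ?_ ?_ ?_
  · intro t s
    fin_cases t <;> simp [O, AB, AC, BC, ZA, ZB, ZC] <;> (try refine ⟨?_, ?_⟩) <;>
      (try refine ⟨?_, ?_⟩) <;> fun_prop
  · intro t g g' hP hD
    have hD1 := hD p hp
    have hD2 := hD q hq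
    have hD3 := hD r hr
    fin_cases t <;> simp [O, AB, AC, BC, ZA, ZB, ZC, hD1, hD2, hD3]
  · intro g hg s
    have hO : ∀ j i t c, O j i t c g s = g j t 0 * s i c + g j t 1 * s i (c + 1) +
      g j t 2 * s i (c + 2) := fun j i t c => rfl
    have hAB0 : AB g 0 s = O q p 0 0 g s + O p q 2 0 g s := rfl
    have hAB1 : AB g 1 s = O q p 1 3 g s + O p q 3 3 g s := rfl
    have hAC0 : AC g 0 s = O r p 0 0 g s + O p r 4 0 g s := rfl
    have hAC1 : AC g 1 s = O r p 1 3 g s + O p r 5 3 g s := rfl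
    have hBC0 : BC g 0 s = O r q 2 0 g s + O q r 4 0 g s := rfl
    have hBC1 : BC g 1 s = O r q 3 3 g s + O q r 5 3 g s := rfl
    have hZC : ZC g s = g r 6 0 * AB g 0 s + g r 6 1 * AB g 1 s := by simp [ZC]
    have hZB : ZB g s = g q 7 0 * AC g 0 s + g q 7 1 * AC g 1 s := by simp [ZB]
    have hZA : ZA g s = g p 8 0 * BC g 0 s + g p 8 1 * BC g 1 s := by simp [ZA]
    refine ⟨?_, ?_, ?_⟩ <;> intro h i hi <;> have h0 := h 0 <;> have h1 := h 1 <;>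
      have h2 := h 2 <;> have h3 := h 3 <;> have h4 := h 4 <;> have h5 := h 5 <;>
      have h6 := h 6 <;> have h7 := h 7 <;> have h8 := h 8 <;> have h9 := h 9 <;>
      have h10 := h 10 <;> clear h <;>
      simp only [Fin.isValue, Matrix.cons_val, LinearMap.zero_apply, mul_zero, add_zero,
        sym_apply] at h0 h1 h2 h3 h4 h5 h6 h7 h8 h9 h10
    · rw [← hZA] at h8
      obtain ⟨e1, e2⟩ := eq_zero_of_minor (hg.minor p 9 p 10 1 2 (Or.inr (by decide)) (by decide))
        (x := ZB g s) (y := ZC g s) (by linear_combination h9 - g p 9 0 * h8)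
        (by linear_combination h10 - g p 10 0 * h8)
      obtain ⟨e3, e4⟩ := eq_zero_of_minor (hg.minor p 6 r 6 0 1 (Or.inl hpr) (by decide))
        (x := AB g 0 s) (y := AB g 1 s) h6 (by rw [← hZC, e2])
      obtain ⟨e5, e6⟩ := eq_zero_of_minor (hg.minor p 7 q 7 0 1 (Or.inl hpq) (by decide))
        (x := AC g 0 s) (y := AC g 1 s) h7 (by rw [← hZB, e1])
      simp only [hO, zero_add, Nat.reduceAdd] at hAB0 hAB1 hAC0 hAC1
      have d := eq_zero_of_det₃ (hg.det p q r 0 hpq hqr hpr) h0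
        (by linear_combination e3 - hAB0 - h2) (by linear_combination e5 - hAC0 - h4)
      have d' := eq_zero_of_det₃ (hg.det p q r 1 hpq hqr hpr) h1
        (by linear_combination e4 - hAB1 - h3) (by linear_combination e6 - hAC1 - h5)
      interval_cases i
      exacts [d.1, d.2.1, d.2.2, d'.1, d'.2.1, d'.2.2]
    · rw [← hZB] at h7
      obtain ⟨e1, e2⟩ := eq_zero_of_minor (hg.minor q 9 q 10 0 2 (Or.inr (by decide)) (by decide))
        (x := ZA g s) (y := ZC g s) (by linear_combination h9 - g q 9 1 * h7)
        (by linear_combination h10 - g q 10 1 * h7)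
      obtain ⟨e3, e4⟩ := eq_zero_of_minor (hg.minor q 6 r 6 0 1 (Or.inl hqr) (by decide))
        (x := AB g 0 s) (y := AB g 1 s) h6 (by rw [← hZC, e2])
      obtain ⟨e5, e6⟩ := eq_zero_of_minor (hg.minor q 8 p 8 0 1 (Or.inl hpq.symm) (by decide))
        (x := BC g 0 s) (y := BC g 1 s) h8 (by rw [← hZA, e1])
      simp only [hO, zero_add, Nat.reduceAdd] at hAB0 hAB1 hBC0 hBC1
      have d := eq_zero_of_det₃ (hg.det p q r 2 hpq hqr hpr)
        (by linear_combination e3 - hAB0 - h0) h2 (by linear_combination e5 - hBC0 - h4)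
      have d' := eq_zero_of_det₃ (hg.det p q r 3 hpq hqr hpr)
        (by linear_combination e4 - hAB1 - h1) h3 (by linear_combination e6 - hBC1 - h5)
      interval_cases i
      exacts [d.1, d.2.1, d.2.2, d'.1, d'.2.1, d'.2.2]
    · rw [← hZC] at h6
      obtain ⟨e1, e2⟩ := eq_zero_of_minor (hg.minor r 9 r 10 0 1 (Or.inr (by decide)) (by decide))
        (x := ZA g s) (y := ZB g s) (by linear_combination h9 - g r 9 2 * h6)
        (by linear_combination h10 - g r 10 2 * h6)
      obtain ⟨e3, e4⟩ := eq_zero_of_minor (hg.minor r 7 q 7 0 1 (Or.inl hqr.symm) (by decide))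
        (x := AC g 0 s) (y := AC g 1 s) h7 (by rw [← hZB, e2])
      obtain ⟨e5, e6⟩ := eq_zero_of_minor (hg.minor r 8 p 8 0 1 (Or.inl hpr.symm) (by decide))
        (x := BC g 0 s) (y := BC g 1 s) h8 (by rw [← hZA, e1])
      simp only [hO, zero_add, Nat.reduceAdd] at hAC0 hAC1 hBC0 hBC1
      have d := eq_zero_of_det₃ (hg.det p q r 4 hpq hqr hpr)
        (by linear_combination e3 - hAC0 - h0) (by linear_combination e5 - hBC0 - h2) h4
      have d' := eq_zero_of_det₃ (hg.det p q r 5 hpq hqr hpr)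
        (by linear_combination e4 - hAC1 - h1) (by linear_combination e6 - hBC1 - h3) h5
      interval_cases i
      exacts [d.1, d.2.1, d.2.2, d'.1, d'.2.1, d'.2.2]

end LongerSchemes

section TimeSharing

variable {m : ℕ} {I : Fin 3 → CSITState} {μ : Measure ℂ} [IsProbabilityMeasure μ]

theorem univ_eq_of_ne {p q r : Fin 3} (hpq : p ≠ q) (hqr : q ≠ r) (hpr : p ≠ r) :
    (Finset.univ : Finset (Fin 3)) = {p, q, r} := by
  decide +revert

theorem sum_filter_three {p q r : Fin 3} (hpq : p ≠ q) (hqr : q ≠ r) (hpr : p ≠ r)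
    (P : Fin 3 → Prop) [DecidablePred P] (f : Fin 3 → ℝ) :
    ∑ j ∈ Finset.univ.filter P, f j =
      (if P p then f p else 0) + (if P q then f q else 0) + (if P r then f r else 0) := by
  rw [Finset.sum_filter, univ_eq_of_ne hpq hqr hpr, Finset.sum_insert (by simp [hpq, hpr]),
    Finset.sum_insert (by simp [hqr]), Finset.sum_singleton, add_assoc]

/-- Time sharing between three schemes serving three receivers. -/
theorem linAchievable_of_triples {p q r : Fin 3} (hpq : p ≠ q) (hqr : q ≠ r) (hpr : p ≠ r)
    {d : Fin 3 → ℝ} (hd : ∀ j, 0 ≤ d j ∧ d j ≤ 1) {a₁ b₁ c₁ a₂ b₂ c₂ a₃ b₃ c₃ : ℝ}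
    (h₁ : DeliversRate m I μ (triple p q r a₁ b₁ c₁))
    (h₂ : DeliversRate m I μ (triple p q r a₂ b₂ c₂))
    (h₃ : DeliversRate m I μ (triple p q r a₃ b₃ c₃)) (w₁ w₂ w₃ : ℝ)
    (hw₁ : 0 ≤ w₁) (hw₂ : 0 ≤ w₂) (hw₃ : 0 ≤ w₃) (hw : w₁ + w₂ + w₃ ≤ 1)
    (hp : d p ≤ w₁ * a₁ + w₂ * a₂ + w₃ * a₃) (hq : d q ≤ w₁ * b₁ + w₂ * b₂ + w₃ * b₃)
    (hr : d r ≤ w₁ * c₁ + w₂ * c₂ + w₃ * c₃) : LinAchievable 3 m I μ d := by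
  refine linAchievable_of_deliversRate
    (v := ![triple p q r a₁ b₁ c₁, triple p q r a₂ b₂ c₂, triple p q r a₃ b₃ c₃])
    (w := ![w₁, w₂, w₃]) ?_ ?_ ?_ hd ?_
  · intro i
    fin_cases i
    exacts [h₁, h₂, h₃]
  · intro i
    fin_cases i
    exacts [hw₁, hw₂, hw₃]
  · simpa [Fin.sum_univ_three] using hw
  · intro j
    have hj : j ∈ ({p, q, r} : Finset (Fin 3)) :=
      univ_eq_of_ne hpq hqr hpr ▸ Finset.mem_univ j
    simp only [Finset.mem_insert, Finset.mem_singleton] at hj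
    rcases hj with rfl | rfl | rfl
    · simpa [Fin.sum_univ_three, triple] using hp
    · simpa [Fin.sum_univ_three, triple, hpq.symm] using hq
    · simpa [Fin.sum_univ_three, triple, hpr.symm, hqr.symm] using hr

end TimeSharing

section Rates

variable {k m : ℕ} {I : Fin k → CSITState} {μ : Measure ℂ} {p q r : Fin k}

theorem Delivers.deliversRate {n a b c : ℕ} (h : Delivers m I μ n (triple p q r a b c))
    (hn : 0 < n) : DeliversRate m I μ (triple p q r (a / n : ℝ) (b / n) (c / n)) := by
  refine ⟨n, _, hn, h, fun j => ?_⟩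
  unfold triple
  split_ifs <;> simp

variable [IsProbabilityMeasure μ] [NullSingletonClass μ]

theorem rate_fst (hm : 3 ≤ m) : DeliversRate m I μ (triple p q r 1 0 0) := by
  refine ⟨1, _, one_pos, delivers_single hm p, fun j => ?_⟩
  unfold triple
  split_ifs <;> simp

theorem rate_snd (hm : 3 ≤ m) (hpq : p ≠ q) : DeliversRate m I μ (triple p q r 0 1 0) := by
  refine ⟨1, _, one_pos, delivers_single hm q, fun j => ?_⟩
  unfold triple
  split_ifs <;> simp_all

theorem rate_trd (hm : 3 ≤ m) (hqr : q ≠ r) (hpr : p ≠ r) :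
    DeliversRate m I μ (triple p q r 0 0 1) := by
  refine ⟨1, _, one_pos, delivers_single hm r, fun j => ?_⟩
  unfold triple
  split_ifs <;> simp_all

theorem rate_PP (hm : 3 ≤ m) (hp : I p = CSITState.P) (hq : I q = CSITState.P) (hpq : p ≠ q) :
    DeliversRate m I μ (triple p q r 1 1 0) := by
  refine ⟨1, _, one_pos, delivers_PP hm hp hq hpq, fun j => ?_⟩
  unfold triple
  split_ifs <;> simp

theorem rate_PD (hm : 3 ≤ m) (hp : I p = CSITState.P) (hq : I q = CSITState.D) (hpq : p ≠ q) :
    DeliversRate m I μ (triple p q r 1 (1 / 2) 0) := by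
  refine ⟨2, _, two_pos, delivers_PD hm hp hq hpq, fun j => ?_⟩
  unfold triple
  split_ifs <;> simp

theorem rate_P_D (hm : 3 ≤ m) (hp : I p = CSITState.P) (hr : I r = CSITState.D) (hqr : q ≠ r)
    (hpr : p ≠ r) : DeliversRate m I μ (triple p q r 1 0 (1 / 2)) := by
  refine ⟨2, _, two_pos, delivers_PD hm hp hr hpr, fun j => ?_⟩
  unfold triple
  split_ifs <;> simp_all

theorem rate_DD (hm : 3 ≤ m) (hp : I p = CSITState.D) (hq : I q = CSITState.D) (hpq : p ≠ q) :
    DeliversRate m I μ (triple p q r (2 / 3) (2 / 3) 0) := by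
  refine ⟨3, _, three_pos, delivers_DD hm hp hq hpq, fun j => ?_⟩
  unfold triple
  split_ifs <;> simp

theorem rate_DD_snd (hm : 3 ≤ m) (hq : I q = CSITState.D) (hr : I r = CSITState.D) (hpq : p ≠ q)
    (hqr : q ≠ r) (hpr : p ≠ r) : DeliversRate m I μ (triple p q r 0 (2 / 3) (2 / 3)) := by
  refine ⟨3, _, three_pos, delivers_DD hm hq hr hqr, fun j => ?_⟩
  unfold triple
  split_ifs <;> simp_all

end Rates

section Converse

variable {m : ℕ} {I : Fin 3 → CSITState} {μ : Measure ℂ} [IsProbabilityMeasure μ]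
  [NullSingletonClass μ] {d : Fin 3 → ℝ}

theorem exists_ne_ne (a : Fin 3) : ∃ b c, a ≠ b ∧ b ≠ c ∧ a ≠ c := by
  decide +revert

theorem exists_ne_ne_of_ne {a b : Fin 3} (hab : a ≠ b) : ∃ c, b ≠ c ∧ a ≠ c := by
  decide +revert

theorem LDoFRegion_delayed_first_le (hd : d ∈ LDoFRegion 3 m I μ)
    (e : Fin ((stateD 3 I).card) ≃ {x // x ∈ stateD 3 I}) :
    (∑ j ∈ stateP 3 I, d j / (3 : ℝ)) + (∑ j, d (e j).1 / ((j : ℕ) + 1 : ℝ)) +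
      ∑ j ∈ stateN 3 I, d j ≤ 1 := by
  obtain ⟨c, hc, v, hv, hD, hsum⟩ : ∃ c ≤ 3, ∃ v : Fin c → Fin 3, Function.Injective v ∧
      (∀ x, I x = CSITState.D ↔ ∃ j, v j = x) ∧
      ∑ j, d (e j).1 / ((j : ℕ) + 1 : ℝ) = ∑ j, d (v j) / ((j : ℕ) + 1 : ℝ) := by
    refine ⟨_, Finset.card_le_univ (stateD 3 I), fun j => (e j).1,
      Subtype.val_injective.comp e.injective, fun x => ⟨fun hx => ?_, ?_⟩, rfl⟩
    · exact ⟨e.symm ⟨x, mem_stateD.mpr hx⟩, by simp⟩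
    · rintro ⟨j, rfl⟩
      exact mem_stateD.mp (e j).2
  rw [hsum]
  have hb := LDoFRegion_bounds hd
  have hm : ∀ {x}, I x = CSITState.P → x ∈ stateP 3 I ∪ stateD 3 I := fun h =>
    Finset.mem_union_left _ (mem_stateP.mpr h)
  have hm' : ∀ {x}, I x = CSITState.D → x ∈ stateP 3 I ∪ stateD 3 I := fun h =>
    Finset.mem_union_right _ (mem_stateD.mpr h)
  interval_cases c
  · have hN := LDoFRegion_sum_le hd
    have h1 : ∑ j ∈ stateP 3 I, d j / (3 : ℝ) ≤
        ∑ j ∈ stateP 3 I, (1 - ∑ j ∈ stateN 3 I, d j) / 3 :=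
      Finset.sum_le_sum fun j hj => by
        linarith [LDoFRegion_single_le hd (Finset.mem_union_left (stateD 3 I) hj)]
    have h2 : ((stateP 3 I).card : ℝ) ≤ 3 := by
      exact_mod_cast (stateP 3 I).card_le_univ
    rw [Finset.sum_const, nsmul_eq_mul] at h1
    rw [Fin.sum_univ_zero]
    nlinarith
  · obtain ⟨b, c, hab, hbc, hac⟩ := exists_ne_ne (v 0)
    have ha : I (v 0) = CSITState.D := (hD _).mpr ⟨0, rfl⟩
    have hbD : I b ≠ CSITState.D := fun h => by
      obtain ⟨j, rfl⟩ := (hD _).mp h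
      exact hab (congrArg v (Subsingleton.elim _ _))
    have hcD : I c ≠ CSITState.D := fun h => by
      obtain ⟨j, rfl⟩ := (hD _).mp h
      exact hac (congrArg v (Subsingleton.elim _ _))
    have h0 := LDoFRegion_single_le hd (hm' ha)
    have h1 : ∀ x, x ≠ v 0 → I x = CSITState.P →
        d x / 2 + d (v 0) + ∑ j ∈ stateN 3 I, d j ≤ 1 := fun x hx hxP => by
      simpa using LDoFRegion_delayed_le hd (mem_stateD.mpr ha) ![x]
        (Function.injective_of_subsingleton _) (by simp [hx, hm hxP])
    have h2 : ∀ x y, x ≠ v 0 → y ≠ v 0 → x ≠ y → I x = CSITState.P → I y = CSITState.P →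
        d x / 2 + d y / 4 + d (v 0) + ∑ j ∈ stateN 3 I, d j ≤ 1 := fun x y hx hy hxy hxP hyP => by
      have := LDoFRegion_delayed_le hd (mem_stateD.mpr ha) ![x, y]
        (by rw [← List.nodup_ofFn]; simp [hxy]) (Fin.forall_fin_two.mpr
          ⟨Finset.mem_erase.mpr ⟨hx, hm hxP⟩, Finset.mem_erase.mpr ⟨hy, hm hyP⟩⟩)
      norm_num [Fin.sum_univ_two] at this
      exact this
    rw [Fin.sum_univ_one, stateP, sum_filter_three hab hbc hac]
    simp only [ha, reduceCtorEq, if_false, Fin.val_zero, Nat.cast_zero, zero_add, div_one]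
    split_ifs with hbP hcP hcP
    · linarith [h2 b c hab.symm hac.symm hbc hbP hcP, h2 c b hac.symm hab.symm hbc.symm hcP hbP,
        (hb b).1, (hb c).1]
    · linarith [h1 b hab.symm hbP, (hb b).1]
    · linarith [h1 c hac.symm hcP, (hb c).1]
    · linarith
  · have hab : v 0 ≠ v 1 := hv.ne (by decide)
    obtain ⟨c, hbc, hac⟩ := exists_ne_ne_of_ne hab
    have ha : I (v 0) = CSITState.D := (hD _).mpr ⟨0, rfl⟩
    have hb' : I (v 1) = CSITState.D := (hD _).mpr ⟨1, rfl⟩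
    rw [Fin.sum_univ_two, stateP, sum_filter_three hab hbc hac]
    simp only [ha, hb', reduceCtorEq, if_false]
    norm_num
    split_ifs with hcP
    · linarith [LDoFRegion_delayed_pair_le hd (mem_stateD.mpr ha) (mem_stateD.mpr hb') (hm hcP)
        hab hac hbc]
    · have := LDoFRegion_delayed_le hd (mem_stateD.mpr ha) ![v 1]
        (Function.injective_of_subsingleton _) (by simp [hab.symm, hm' hb'])
      norm_num at this
      linarith
  · have h0 : v 0 ≠ v 1 := hv.ne (by decide)
    have h1 : v 1 ≠ v 2 := hv.ne (by decide)
    have h2 : v 0 ≠ v 2 := hv.ne (by decide)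
    have ha : ∀ j, I (v j) = CSITState.D := fun j => (hD _).mpr ⟨j, rfl⟩
    have := LDoFRegion_delayed_pair_le hd (mem_stateD.mpr (ha 0)) (mem_stateD.mpr (ha 1))
      (hm' (ha 2)) h0 h2 h1
    rw [Fin.sum_univ_three, stateP, sum_filter_three h0 h1 h2]
    simp only [ha, reduceCtorEq, if_false]
    norm_num
    linarith

end Converse

section Vertices

variable {m : ℕ} {I : Fin 3 → CSITState} {μ : Measure ℂ} [IsProbabilityMeasure μ]
  [NullSingletonClass μ] {p q r : Fin 3} {d : Fin 3 → ℝ}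

theorem linAchievable_of_sum_le (hm : 3 ≤ m) (hpq : p ≠ q) (hqr : q ≠ r) (hpr : p ≠ r)
    (hd : ∀ j, 0 ≤ d j ∧ d j ≤ 1) (h : d p + d q + d r ≤ 1) : LinAchievable 3 m I μ d :=
  linAchievable_of_triples hpq hqr hpr hd (rate_fst hm) (rate_snd hm hpq) (rate_trd hm hqr hpr)
    (d p) (d q) (d r) (hd p).1 (hd q).1 (hd r).1 h (by linarith) (by linarith) (by linarith)

theorem linAchievable_PP (hm : 3 ≤ m) (hpq : p ≠ q) (hqr : q ≠ r) (hpr : p ≠ r)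
    (hd : ∀ j, 0 ≤ d j ∧ d j ≤ 1) (hp : I p = CSITState.P) (hq : I q = CSITState.P)
    (h : d p + d r ≤ 1) (h' : d q + d r ≤ 1) : LinAchievable 3 m I μ d := by
  rcases le_total (d q) (d p) with hle | hle
  · exact linAchievable_of_triples hpq hqr hpr hd (rate_PP hm hp hq hpq) (rate_fst hm)
      (rate_trd hm hqr hpr) (d q) (d p - d q) (d r) (hd q).1 (by linarith) (hd r).1
      (by linarith) (by linarith) (by linarith) (by linarith)
  · exact linAchievable_of_triples hpq hqr hpr hd (rate_PP hm hp hq hpq) (rate_snd hm hpq)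
      (rate_trd hm hqr hpr) (d p) (d q - d p) (d r) (hd p).1 (by linarith) (hd r).1
      (by linarith) (by linarith) (by linarith) (by linarith)

theorem linAchievable_PD (hm : 3 ≤ m) (hpq : p ≠ q) (hqr : q ≠ r) (hpr : p ≠ r)
    (hd : ∀ j, 0 ≤ d j ∧ d j ≤ 1) (hp : I p = CSITState.P) (hq : I q = CSITState.D)
    (h : d p + d r ≤ 1) (h' : d p / 2 + d q + d r ≤ 1) : LinAchievable 3 m I μ d :=
  linAchievable_of_triples hpq hqr hpr hd (rate_PD hm hp hq hpq) (rate_snd hm hpq)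
    (rate_trd hm hqr hpr) (d p) (1 - d p - d r) (d r) (hd p).1 (by linarith) (hd r).1
    (by linarith) (by linarith) (by linarith) (by linarith)

theorem linAchievable_DD (hm : 3 ≤ m) (hpq : p ≠ q) (hqr : q ≠ r) (hpr : p ≠ r)
    (hd : ∀ j, 0 ≤ d j ∧ d j ≤ 1) (hp : I p = CSITState.D) (hq : I q = CSITState.D)
    (h : d p + d q / 2 + d r ≤ 1) (h' : d q + d p / 2 + d r ≤ 1) : LinAchievable 3 m I μ d := by
  have hp0 := (hd p).1
  have hq0 := (hd q).1
  rcases le_total (d q) (d p) with hle | hle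
  · exact linAchievable_of_triples hpq hqr hpr hd (rate_DD hm hp hq hpq) (rate_fst hm)
      (rate_trd hm hqr hpr) (3 / 2 * d q) (d p - d q) (d r) (by linarith) (by linarith) (hd r).1
      (by linarith) (by linarith) (by linarith) (by linarith)
  · exact linAchievable_of_triples hpq hqr hpr hd (rate_DD hm hp hq hpq) (rate_snd hm hpq)
      (rate_trd hm hqr hpr) (3 / 2 * d p) (d q - d p) (d r) (by linarith) (by linarith) (hd r).1
      (by linarith) (by linarith) (by linarith) (by linarith)

theorem linAchievable_PPP (hm : 3 ≤ m) (hpq : p ≠ q) (hqr : q ≠ r) (hpr : p ≠ r)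
    (hd : ∀ j, 0 ≤ d j ∧ d j ≤ 1) (hp : I p = CSITState.P) (hq : I q = CSITState.P)
    (hr : I r = CSITState.P) : LinAchievable 3 m I μ d := by
  have h := (delivers_PPP (μ := μ) hm hp hq hr hpq hqr hpr).deliversRate one_pos
  norm_num at h
  exact linAchievable_of_triples hpq hqr hpr hd h h h 1 0 0 zero_le_one le_rfl le_rfl
    (by norm_num) (by linarith [(hd p).2]) (by linarith [(hd q).2]) (by linarith [(hd r).2])

theorem linAchievable_PPD (hm : 3 ≤ m) (hpq : p ≠ q) (hqr : q ≠ r) (hpr : p ≠ r)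
    (hd : ∀ j, 0 ≤ d j ∧ d j ≤ 1) (hp : I p = CSITState.P) (hq : I q = CSITState.P)
    (hr : I r = CSITState.D) (hle : d q ≤ d p) (h : d p / 2 + d q / 4 + d r ≤ 1) :
    LinAchievable 3 m I μ d := by
  have h1 := (delivers_PPD (μ := μ) hm hp hq hr hpq hqr hpr).deliversRate four_pos
  norm_num at h1
  exact linAchievable_of_triples hpq hqr hpr hd h1 (rate_P_D hm hp hr hqr hpr)
    (rate_trd hm hqr hpr) (d q) (d p - d q) (1 - d p) (hd q).1 (by linarith)
    (by linarith [(hd p).2]) (by linarith) (by linarith) (by linarith) (by linarith)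

theorem linAchievable_PDD (hm : 3 ≤ m) (hpq : p ≠ q) (hqr : q ≠ r) (hpr : p ≠ r)
    (hd : ∀ j, 0 ≤ d j ∧ d j ≤ 1) (hp : I p = CSITState.P) (hq : I q = CSITState.D)
    (hr : I r = CSITState.D) (hle : d r ≤ d q) (h : d p / 2 + d r / 4 + d q ≤ 1)
    (h' : d p / 3 + d q + d r / 2 ≤ 1) : LinAchievable 3 m I μ d := by
  have hp0 := hd p
  have hr0 := hd r
  have h3 := (delivers_PDD_three (μ := μ) hm hp hq hr hpq hqr hpr).deliversRate four_pos
  have h5 := (delivers_PDD_five (μ := μ) hm hp hq hr hpq hqr hpr).deliversRate (by norm_num)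
  norm_num at h3 h5
  rcases le_total (d r) (2 * d p / 5) with h1 | h1
  · exact linAchievable_of_triples hpq hqr hpr hd h5 (rate_PD hm hp hq hpq) (rate_snd hm hpq)
      (5 / 2 * d r) (d p - 5 / 2 * d r) (1 - d p) (by linarith) (by linarith) (by linarith)
      (by linarith) (by linarith) (by linarith) (by linarith)
  rcases le_total (d r) (2 * d p / 3) with h2 | h2
  · exact linAchievable_of_triples hpq hqr hpr hd h5 h3 (rate_snd hm hpq)
      (5 / 2 * d p - 15 / 4 * d r) (5 * d r - 2 * d p) (1 - d p / 2 - 5 / 4 * d r) (by linarith)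
      (by linarith) (by linarith) (by linarith) (by linarith) (by linarith) (by linarith)
  · exact linAchievable_of_triples hpq hqr hpr hd h3 (rate_DD_snd hm hq hr hpq hqr hpr)
      (rate_snd hm hpq) (4 / 3 * d p) (3 / 2 * (d r - 2 / 3 * d p))
      (1 - d p / 3 - 3 / 2 * d r) (by linarith) (by linarith) (by linarith) (by linarith)
      (by linarith) (by linarith) (by linarith)

theorem linAchievable_DDD (hm : 3 ≤ m) (hpq : p ≠ q) (hqr : q ≠ r) (hpr : p ≠ r)
    (hd : ∀ j, 0 ≤ d j ∧ d j ≤ 1) (hp : I p = CSITState.D) (hq : I q = CSITState.D)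
    (hr : I r = CSITState.D) (hle : d q ≤ d p) (hle' : d r ≤ d q)
    (h : d p + d q / 2 + d r / 3 ≤ 1) : LinAchievable 3 m I μ d := by
  have hr0 := hd r
  have h1 := (delivers_DDD (μ := μ) hm hp hq hr hpq hqr hpr).deliversRate (by norm_num)
  norm_num at h1
  exact linAchievable_of_triples hpq hqr hpr hd h1 (rate_DD hm hp hq hpq) (rate_fst hm)
    (11 / 6 * d r) (3 / 2 * (d q - d r)) (d p - d q) (by linarith) (by linarith) (by linarith)
    (by linarith) (by linarith) (by linarith) (by linarith)

end Vertices

section Region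

variable {m : ℕ} {I : Fin 3 → CSITState} {μ : Measure ℂ} [IsProbabilityMeasure μ]
  [NullSingletonClass μ] {d : Fin 3 → ℝ}

theorem exists_enumeration {k c : ℕ} (A : Finset (Fin k)) (v : Fin c → Fin k)
    (hv : Function.Injective v) (hA : ∀ x, x ∈ A ↔ ∃ j, v j = x) :
    ∃ e : Fin A.card ≃ {x // x ∈ A}, ∀ (d : Fin k → ℝ) (w : ℕ → ℝ),
      ∑ j, d (e j).1 / w j = ∑ j, d (v j) / w j := by
  have hc : A.card = c := by
    rw [show A = Finset.univ.image v by ext x; simp [hA], Finset.card_image_of_injective _ hv,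
      Finset.card_fin]
  subst hc
  refine ⟨Equiv.ofBijective (fun j => ⟨v j, (hA _).mpr ⟨j, rfl⟩⟩)
    ⟨fun i j h => hv (congrArg Subtype.val h), fun x => ?_⟩, fun d w => rfl⟩
  obtain ⟨j, hj⟩ := (hA x.1).mp x.2
  exact ⟨j, Subtype.ext hj⟩

theorem exists_perm_antitone {α : Type*} [LinearOrder α] (f : Fin 3 → α) :
    ∃ p q r : Fin 3, p ≠ q ∧ q ≠ r ∧ p ≠ r ∧ f q ≤ f p ∧ f r ≤ f q := by
  let σ := Tuple.sort f
  have h := Tuple.monotone_sort f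
  exact ⟨σ 2, σ 1, σ 0, σ.injective.ne (by decide), σ.injective.ne (by decide),
    σ.injective.ne (by decide), h (by decide : (1 : Fin 3) ≤ 2), h (by decide : (0 : Fin 3) ≤ 1)⟩

/-- Ranks the feedback states by decreasing quality of the channel knowledge. -/
def CSITState.quality : CSITState → ℕ
  | .P => 2
  | .D => 1
  | .N => 0

set_option linter.unusedSimpArgs false in
theorem linAchievable_of_bounds (hm : 3 ≤ m) (hd : ∀ j, 0 ≤ d j ∧ d j ≤ 1)
    (h2 : ∀ i ∈ stateD 3 I, ∀ e : Fin (((stateP 3 I ∪ stateD 3 I).erase i).card) ≃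
      {x // x ∈ (stateP 3 I ∪ stateD 3 I).erase i},
        (∑ j, d (e j).1 / (2 : ℝ) ^ ((j : ℕ) + 1)) + d i + ∑ j ∈ stateN 3 I, d j ≤ 1)
    (h3 : ∀ e : Fin ((stateD 3 I).card) ≃ {x // x ∈ stateD 3 I},
      (∑ j ∈ stateP 3 I, d j / (3 : ℝ)) + (∑ j, d (e j).1 / ((j : ℕ) + 1 : ℝ)) +
        ∑ j ∈ stateN 3 I, d j ≤ 1)
    (h4 : ∀ i ∈ stateP 3 I ∪ stateD 3 I, d i + ∑ j ∈ stateN 3 I, d j ≤ 1) :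
    LinAchievable 3 m I μ d := by
  have h2' : ∀ i, I i = CSITState.D → ∀ (c : ℕ) (v : Fin c → Fin 3), Function.Injective v →
      (∀ x, (x ≠ i ∧ (I x = CSITState.P ∨ I x = CSITState.D)) ↔ ∃ j, v j = x) →
      (∑ j, d (v j) / (2 : ℝ) ^ ((j : ℕ) + 1)) + d i + ∑ j ∈ stateN 3 I, d j ≤ 1 := by
    intro i hi c v hv hA
    obtain ⟨e, he⟩ := exists_enumeration ((stateP 3 I ∪ stateD 3 I).erase i) v hv fun x => by
      rw [← hA, Finset.mem_erase, Finset.mem_union, mem_stateP, mem_stateD]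
    have := h2 i (mem_stateD.mpr hi) e
    rwa [he d fun j => (2 : ℝ) ^ (j + 1)] at this
  have h3' : ∀ (c : ℕ) (v : Fin c → Fin 3), Function.Injective v →
      (∀ x, I x = CSITState.D ↔ ∃ j, v j = x) →
      (∑ j ∈ stateP 3 I, d j / (3 : ℝ)) + (∑ j, d (v j) / ((j : ℕ) + 1 : ℝ)) +
        ∑ j ∈ stateN 3 I, d j ≤ 1 := by
    intro c v hv hA
    obtain ⟨e, he⟩ := exists_enumeration (stateD 3 I) v hv fun x => by rw [← hA, mem_stateD]
    have := h3 e
    rwa [he d fun j => (j : ℝ) + 1] at this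
  have h4' : ∀ i, (I i = CSITState.P ∨ I i = CSITState.D) → d i + ∑ j ∈ stateN 3 I, d j ≤ 1 :=
    fun i hi => h4 i (by rwa [Finset.mem_union, mem_stateP, mem_stateD])
  clear h2 h3 h4
  obtain ⟨p, q, r, hpq, hqr, hpr, hle, hle'⟩ := exists_perm_antitone fun j => (I j).quality
  have hall : ∀ x, x = p ∨ x = q ∨ x = r := fun x => by
    have := Finset.mem_univ x
    rwa [univ_eq_of_ne hpq hqr hpr, Finset.mem_insert, Finset.mem_insert,
      Finset.mem_singleton] at this
  have hcov : ∀ {Q : Fin 3 → Prop}, Q p → Q q → Q r → ∀ x, Q x := fun h h' h'' x => by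
    rcases hall x with rfl | rfl | rfl
    exacts [h, h', h'']
  have hinj2 : ∀ {a b : Fin 3}, a ≠ b → Function.Injective ![a, b] := fun h => by
    rw [← List.nodup_ofFn]
    simp [h]
  have hinj3 : ∀ {a b c : Fin 3}, a ≠ b → b ≠ c → a ≠ c → Function.Injective ![a, b, c] :=
    fun h h' h'' => by
      rw [← List.nodup_ofFn]
      simp [h, h', h'']
  rw [stateN, sum_filter_three hpq hqr hpr] at h2' h3' h4'
  rw [stateP, sum_filter_three hpq hqr hpr] at h3'
  rcases hp : I p with _ | _ | _ <;> rcases hq : I q with _ | _ | _ <;>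
    rcases hr : I r with _ | _ | _ <;> simp only [hp, hq, hr, CSITState.quality] at hle hle' <;>
    first | omega | clear hle hle'
  all_goals simp only [hp, hq, hr, reduceCtorEq, if_true, if_false, add_zero,
    zero_add] at h2' h3' h4'
  · exact linAchievable_PPP hm hpq hqr hpr hd hp hq hr
  · have a1 := h2' r hr 2 ![p, q] (hinj2 hpq) (by
      refine hcov ?_ ?_ ?_ <;>
        simp [hp, hq, hr, hpq, hqr, hpr, hpq.symm, hqr.symm, hpr.symm])
    have a2 := h2' r hr 2 ![q, p] (hinj2 hpq.symm) (by
      refine hcov ?_ ?_ ?_ <;>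
        simp [hp, hq, hr, hpq, hqr, hpr, hpq.symm, hqr.symm, hpr.symm])
    norm_num [Fin.sum_univ_two] at a1 a2
    rcases le_total (d q) (d p) with hle | hle
    · exact linAchievable_PPD hm hpq hqr hpr hd hp hq hr hle a1
    · exact linAchievable_PPD hm hpq.symm hpr hqr hd hq hp hr hle a2
  · exact linAchievable_PP hm hpq hqr hpr hd hp hq (h4' p (Or.inl hp)) (h4' q (Or.inl hq))
  · have a1 := h2' q hq 2 ![p, r] (hinj2 hpr) (by
      refine hcov ?_ ?_ ?_ <;>
        simp [hp, hq, hr, hpq, hqr, hpr, hpq.symm, hqr.symm, hpr.symm])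
    have a2 := h2' r hr 2 ![p, q] (hinj2 hpq) (by
      refine hcov ?_ ?_ ?_ <;>
        simp [hp, hq, hr, hpq, hqr, hpr, hpq.symm, hqr.symm, hpr.symm])
    have a3 := h3' 2 ![q, r] (hinj2 hqr) (by
      refine hcov ?_ ?_ ?_ <;>
        simp [hp, hq, hr, hpq, hqr, hpr, hpq.symm, hqr.symm, hpr.symm])
    have a4 := h3' 2 ![r, q] (hinj2 hqr.symm) (by
      refine hcov ?_ ?_ ?_ <;>
        simp [hp, hq, hr, hpq, hqr, hpr, hpq.symm, hqr.symm, hpr.symm])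
    norm_num [Fin.sum_univ_two] at a1 a2 a3 a4
    rcases le_total (d r) (d q) with hle | hle
    · exact linAchievable_PDD hm hpq hqr hpr hd hp hq hr hle a1 (by linarith)
    · exact linAchievable_PDD hm hpr hqr.symm hpq hd hp hr hq hle a2 (by linarith)
  · have a1 := h2' q hq 1 ![p] (Function.injective_of_subsingleton _) (by
      refine hcov ?_ ?_ ?_ <;>
        simp [hp, hq, hr, hpq, hqr, hpr, hpq.symm, hqr.symm, hpr.symm])
    norm_num at a1
    exact linAchievable_PD hm hpq hqr hpr hd hp hq (h4' p (Or.inl hp)) a1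
  · exact linAchievable_of_sum_le hm hpq hqr hpr hd (by linarith [h4' p (Or.inl hp)])
  · obtain ⟨p', q', r', hpq', hqr', hpr', hle, hle'⟩ := exists_perm_antitone d
    have hD : ∀ x, I x = CSITState.D := hcov hp hq hr
    have a1 := h3' 3 ![p', q', r'] (hinj3 hpq' hqr' hpr') fun x => by
      have := Finset.mem_univ x
      rw [univ_eq_of_ne hpq' hqr' hpr'] at this
      simpa [hD, Fin.exists_fin_succ, eq_comm] using this
    norm_num [Fin.sum_univ_three] at a1
    exact linAchievable_DDD hm hpq' hqr' hpr' hd (hD _) (hD _) (hD _) hle hle' a1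
  · have a1 := h2' p hp 1 ![q] (Function.injective_of_subsingleton _) (by
      refine hcov ?_ ?_ ?_ <;>
        simp [hp, hq, hr, hpq, hqr, hpr, hpq.symm, hqr.symm, hpr.symm])
    have a2 := h2' q hq 1 ![p] (Function.injective_of_subsingleton _) (by
      refine hcov ?_ ?_ ?_ <;>
        simp [hp, hq, hr, hpq, hqr, hpr, hpq.symm, hqr.symm, hpr.symm])
    norm_num at a1 a2
    exact linAchievable_DD hm hpq hqr hpr hd hp hq (by linarith) (by linarith)
  · exact linAchievable_of_sum_le hm hpq hqr hpr hd (by linarith [h4' p (Or.inr hp)])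
  · have a1 := h3' 0 ![] (Function.injective_of_subsingleton _) (by
      refine hcov ?_ ?_ ?_ <;>
        simp [hp, hq, hr, hpq, hqr, hpr, hpq.symm, hqr.symm, hpr.symm])
    rw [Fin.sum_univ_zero] at a1
    exact linAchievable_of_sum_le hm hpq hqr hpr hd (by linarith)

end Region

/-- **Theorem 1 (3-user MISO BC with hybrid CSIT).** For any hybrid CSIT configuration
`I` of the 3-user MISO BC, the linear DoF region is exactly the polytope described by
the interference-decomposition, MAT-type, and no-CSIT bounds. -/
theorem ldof_region_three_user (m : ℕ) (hm : 3 ≤ m) (I : Fin 3 → CSITState)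
    (μ : Measure ℂ) [IsProbabilityMeasure μ] (hac : μ ≪ (volume : Measure ℂ)) :
    LDoFRegion 3 m I μ =
      { d : Fin 3 → ℝ |
        (∀ i, 0 ≤ d i ∧ d i ≤ 1) ∧
        (∀ i ∈ stateD 3 I,
          ∀ e : Fin (((stateP 3 I ∪ stateD 3 I).erase i).card) ≃
              {x // x ∈ (stateP 3 I ∪ stateD 3 I).erase i},
            (∑ j, d (e j).1 / (2 : ℝ) ^ ((j : ℕ) + 1)) + d i + ∑ j ∈ stateN 3 I, d j ≤ 1) ∧
        (∀ e : Fin ((stateD 3 I).card) ≃ {x // x ∈ stateD 3 I},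
            (∑ j ∈ stateP 3 I, d j / (3 : ℝ)) +
              (∑ j, d (e j).1 / ((j : ℕ) + 1 : ℝ)) +
              ∑ j ∈ stateN 3 I, d j ≤ 1) ∧
        (∀ i ∈ stateP 3 I ∪ stateD 3 I, d i + ∑ j ∈ stateN 3 I, d j ≤ 1) } := by
  have := nullSingletonClass_of_ac hac
  refine Set.Subset.antisymm (fun d hd => ⟨LDoFRegion_bounds hd, ?_, ?_, ?_⟩)
    fun d hd => subset_closure (linAchievable_of_bounds hm hd.1 hd.2.1 hd.2.2.1 hd.2.2.2)
  · exact fun i hi e => LDoFRegion_delayed_le hd hi (fun j => (e j).1)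
      (Subtype.val_injective.comp e.injective) fun j => (e j).2
  · exact LDoFRegion_delayed_first_le hd
  · exact fun i hi => LDoFRegion_single_le hd hi

end
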